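/- Let p ≥ 10^20 be prime, let e be an even divisor of p−1, and let N, H be integers with 1 ≤ H ≤ 2·p^{5/8}. Then N_e(H) ≥ (φ(e)/e) · ( H − (W(e) − 1) · 3.5751 · H^{1/2} · p^{3/16} · (log p)^{1/4} ), where W(e) = 2^{ω(e)}. -/

import Mathlib

/-- An integer `x` (indivisible by `p`) is `e`-free if for every divisor `d > 1` of `e`
the congruence `x ≡ y ^ d (mod p)` has no solution `y`. -/
def IsEFree (p e : ℕ) (x : ℤ) : Prop :=
  ¬ (p : ℤ) ∣ x ∧ ∀ d : ℕ, d ∣ e → 1 < d → ¬ ∃ y : ℤ, Int.ModEq p x (y ^ d)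

/-- `NcountEFree p e N H` is the number of integers `x` with `N + 1 ≤ x ≤ N + H` that are
indivisible by `p` and `e`-free. -/
noncomputable def NcountEFree (p e : ℕ) (N H : ℤ) : ℕ :=
  {x : ℤ | N + 1 ≤ x ∧ x ≤ N + H ∧ IsEFree p e x}.ncard

section
open Polynomial Finset

/-- Distinct orders of vanishing at `0` make a nontrivial combination nonzero. -/
theorem sum_C_mul_X_pow_mul_ne_zero {K ι : Type*} [Field K] [Fintype ι] (a : ι → K) (n : ι → ℕ)
    (hn : Function.Injective n) (u : ι → K[X]) (hu : ∀ i, (u i).coeff 0 ≠ 0) (ha : a ≠ 0) :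
    ∑ i, C (a i) * (X ^ n i * u i) ≠ 0 := by
  classical
  obtain ⟨i₁, hi₁⟩ := Function.ne_iff.mp ha
  obtain ⟨i, hi, hmin⟩ := exists_min_image (univ.filter fun i => a i ≠ 0) n
    ⟨i₁, by simpa using hi₁⟩
  intro h0
  have hc := congrArg (fun f => f.coeff (n i)) h0
  simp only [finsetSum_coeff, coeff_C_mul, coeff_zero] at hc
  rw [sum_eq_single i] at hc
  · rw [coeff_X_pow_mul', if_pos le_rfl, Nat.sub_self] at hc
    exact mul_ne_zero (by simpa using hi) (hu i) hc
  · intro j _ hj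
    by_cases haj : a j = 0
    · simp [haj]
    · have h1 : n i ≤ n j := hmin j (by simpa using haj)
      have h2 : n i ≠ n j := fun h => hj (hn h).symm
      rw [coeff_X_pow_mul', if_neg (by omega), mul_zero]
  · simp

/-- Stepanov's bound, with Bombieri's use of the Frobenius: over a field with `M ^ 2` elements the
polynomial `X * h` takes values with a prescribed power residue symbol about equally often. -/
theorem stepanov_card_le {K : Type*} [Field K] [Fintype K] [DecidableEq K] (p : ℕ) [Fact p.Prime]
    [CharP K p] {s d L m M : ℕ} (hd : 2 ≤ d) (hL : 1 ≤ L) (hM : M = p ^ s) (hMd : M = d * L + 1)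
    (hcard : Fintype.card K = M ^ 2) (h : K[X]) (h0 : h.coeff 0 ≠ 0) (hm : h.natDegree ≤ m)
    (ζ : K) (hζ : ζ ≠ 0) :
    #{x : K | (x * h.eval x) ^ (L * (M + 1)) = ζ} ≤ (L + (2 * m + 2)) * M := by
  classical
  set B := L + m + 2 with hB
  let τ := Fin d × Fin B × Fin L
  let n : τ → ℕ := fun t => t.2.1 * M + (t.1 * L + t.2.2)
  have hlow : ∀ t : τ, (t.1 : ℕ) * L + t.2.2 < M := by
    rintro ⟨j, k, v⟩
    have := j.2; have := v.2
    have h3 : ((j : ℕ) + 1) * L ≤ d * L := Nat.mul_le_mul_right _ j.2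
    simp only
    nlinarith
  have hn : Function.Injective n := by
    intro t t' htt
    have e1 : (t.1 : ℕ) * L + t.2.2 = t'.1 * L + t'.2.2 := by
      have := congrArg (· % M) htt
      simpa [n, Nat.mul_add_mod', Nat.mod_eq_of_lt (hlow _)] using this
    have e2 : (t.2.1 : ℕ) = t'.2.1 := by
      have e3 : (t.2.1 : ℕ) * M = t'.2.1 * M := by
        have : (t.2.1 : ℕ) * M + (t.1 * L + t.2.2) = t'.2.1 * M + (t'.1 * L + t'.2.2) := htt
        omega
      exact Nat.eq_of_mul_eq_mul_right (by omega) e3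
    have e4 : (t.2.2 : ℕ) = t'.2.2 := by
      have := congrArg (· % L) e1
      simpa [Nat.mul_add_mod', Nat.mod_eq_of_lt t.2.2.2, Nat.mod_eq_of_lt t'.2.2.2] using this
    have e5 : (t.1 : ℕ) = t'.1 := by
      have : (t.1 : ℕ) * L = t'.1 * L := by omega
      exact Nat.eq_of_mul_eq_mul_right (by omega) this
    ext <;> assumption
  let G : K[X] := (X * h) ^ L
  let Φ : (τ → K) → K[X] := fun a =>
    ∑ t : τ, C (a t ^ M * ζ ^ (t.1 : ℕ)) * (G ^ (d - 1 - t.1) * X ^ ((t.2.1 : ℕ) + t.2.2 * M))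
  let Ψ : (τ → K) → K[X] := fun a => ∑ t : τ, C (a t) * (X ^ n t * h ^ (L * t.1))
  set E := (d - 1) * (L * (m + 1)) + B + (L - 1) * M with hE
  have hΦdeg : ∀ a, (Φ a).degree < E := by
    intro a
    refine (degree_sum_le _ _).trans_lt ((Finset.sup_lt_iff (by exact WithBot.bot_lt_coe E)).2 ?_)
    rintro ⟨j, k, v⟩ -
    refine degree_le_natDegree.trans_lt ?_
    rw [Nat.cast_lt]
    refine (natDegree_C_mul_le _ _).trans_lt ?_
    have g1 : (X * h).natDegree ≤ m + 1 := by
      have := natDegree_mul_le (p := (X : K[X])) (q := h)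
      simp only [natDegree_X] at this; omega
    have g2 : (G ^ (d - 1 - j)).natDegree ≤ (d - 1) * (L * (m + 1)) :=
      natDegree_pow_le.trans (Nat.mul_le_mul (by omega)
        (natDegree_pow_le.trans (Nat.mul_le_mul_left _ g1)))
    have g3 : (G ^ (d - 1 - j) * X ^ ((k : ℕ) + v * M)).natDegree ≤ _ :=
      natDegree_mul_le.trans (Nat.add_le_add g2 (natDegree_X_pow_le _))
    refine g3.trans_lt ?_
    have g4 : (v : ℕ) * M ≤ (L - 1) * M := Nat.mul_le_mul_right _ (by omega)
    have := k.2
    omega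
  have hcount : E < Fintype.card τ := by
    simp only [τ, Fintype.card_prod, Fintype.card_fin]
    obtain ⟨d', rfl⟩ : ∃ d', d = d' + 2 := ⟨d - 2, by omega⟩
    obtain ⟨L', rfl⟩ : ∃ L', L = L' + 1 := ⟨L - 1, by omega⟩
    simp only [Nat.add_sub_cancel, hE, hB, hMd, show d' + 2 - 1 = d' + 1 by omega]
    nlinarith [Nat.zero_le (d' * L'), Nat.zero_le (m * L')]
  obtain ⟨a, ha0, haΦ⟩ : ∃ a : τ → K, a ≠ 0 ∧ Φ a = 0 := by
    obtain ⟨a, b, hab, hE'⟩ := Fintype.exists_ne_map_eq_of_card_lt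
      (fun (a : τ → K) (i : Fin E) => (Φ a).coeff i) (by
        simp only [Fintype.card_fun, Fintype.card_fin]
        exact Nat.pow_lt_pow_right Fintype.one_lt_card hcount)
    refine ⟨a - b, sub_ne_zero.2 hab, ?_⟩
    have hsub : Φ (a - b) = Φ a - Φ b := by
      simp only [Φ, ← sum_sub_distrib, ← sub_mul, ← C_sub, Pi.sub_apply, hM, sub_pow_char_pow]
    rw [hsub, sub_eq_zero]
    ext i
    by_cases hi : i < E
    · exact congrFun hE' ⟨i, hi⟩
    · have hi' : (E : WithBot ℕ) ≤ i := by exact_mod_cast not_lt.1 hi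
      rw [coeff_eq_zero_of_degree_lt ((hΦdeg a).trans_le hi'),
        coeff_eq_zero_of_degree_lt ((hΦdeg b).trans_le hi')]
  have hΨ : Ψ a ≠ 0 := sum_C_mul_X_pow_mul_ne_zero a n hn _
    (fun t => by rw [coeff_zero_eq_eval_zero, eval_pow, ← coeff_zero_eq_eval_zero]
                 exact pow_ne_zero _ h0) ha0
  have hΨdeg : (Ψ a).natDegree ≤ (L + (2 * m + 2)) * M := by
    refine natDegree_sum_le_of_forall_le _ _ ?_
    rintro ⟨j, k, v⟩ -
    refine (natDegree_C_mul_le _ _).trans (natDegree_mul_le.trans ?_)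
    rw [natDegree_X_pow]
    have g1 : (h ^ (L * (j : ℕ))).natDegree ≤ L * j * m :=
      natDegree_pow_le.trans (Nat.mul_le_mul_left _ hm)
    have g2 := hlow ⟨j, k, v⟩
    have g3 : L * (j : ℕ) * m ≤ M * m := Nat.mul_le_mul_right _ (by
      simp only at g2; nlinarith)
    have g4 : ((k : ℕ) + 1) * M ≤ B * M := Nat.mul_le_mul_right _ k.2
    simp only [n, hB] at *
    nlinarith
  have hsubset : (univ.filter fun x : K => (x * h.eval x) ^ (L * (M + 1)) = ζ) ⊆
      (Ψ a).roots.toFinset := by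
    intro x hx
    simp only [mem_filter, mem_univ, true_and] at hx
    rw [Multiset.mem_toFinset, mem_roots hΨ, IsRoot.def]
    set g := (x * h.eval x) ^ L with hg
    have hgζ : g ^ (M + 1) = ζ := by rw [hg, ← pow_mul, hx]
    have hg0 : g ≠ 0 := by
      rintro h; rw [h, zero_pow (by omega)] at hgζ; exact hζ hgζ.symm
    have hxQ : x ^ (M * M) = x := by rw [← sq, ← hcard, FiniteField.pow_card]
    have key : (Ψ a).eval x ^ M * g ^ (d - 1) = (Φ a).eval x := by
      simp only [Ψ, Φ, eval_finsetSum, hM, sum_pow_char_pow, sum_mul]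
      refine sum_congr rfl ?_
      rintro ⟨j, k, v⟩ -
      simp only [← hM, eval_mul, eval_C, eval_pow, eval_X, G, ← hg, n]
      have e1 : g ^ (d - 1) = g ^ (j : ℕ) * g ^ (d - 1 - j) := by
        rw [← pow_add]; congr 1; have := j.2; omega
      have e2 : x ^ ((k : ℕ) * M + (j * L + v)) * h.eval x ^ (L * (j : ℕ)) =
          x ^ ((k : ℕ) * M) * x ^ (v : ℕ) * g ^ (j : ℕ) := by
        rw [hg]; ring
      have e3 : (x ^ ((k : ℕ) * M)) ^ M = x ^ (k : ℕ) := by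
        rw [← pow_mul, mul_assoc, mul_comm, pow_mul, hxQ]
      rw [e2, mul_pow, mul_pow, mul_pow, e3, e1, ← hgζ]
      ring
    rw [haΦ, eval_zero] at key
    exact eq_zero_of_pow_eq_zero ((mul_eq_zero.1 key).resolve_right (pow_ne_zero _ hg0))
  calc _ ≤ #(Ψ a).roots.toFinset := card_le_card hsubset
    _ ≤ Multiset.card (Ψ a).roots := Multiset.toFinset_card_le _
    _ ≤ _ := (card_roots' _).trans hΨdeg

section
variable {F : Type*} [Field F] [Fintype F] [DecidableEq F]

/-- The finite set of monic polynomials of degree `n` over a finite field. -/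
noncomputable def monicsOfDegree (F : Type*) [Field F] [Fintype F] [DecidableEq F] (n : ℕ) :
    Finset F[X] :=
  letI := Classical.decEq F[X]
  univ.image fun v : Fin n → F => X ^ n + ∑ i : Fin n, C (v i) * X ^ (i : ℕ)

theorem mem_monicsOfDegree {n : ℕ} {g : F[X]} :
    g ∈ monicsOfDegree F n ↔ g.Monic ∧ g.natDegree = n := by
  classical
  simp only [monicsOfDegree, mem_image, mem_univ, true_and]
  have hlt (v : Fin n → F) : (∑ i : Fin n, C (v i) * X ^ (i : ℕ)).degree < (n : WithBot ℕ) := by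
    refine (degree_sum_le _ _).trans_lt ((Finset.sup_lt_iff (by exact WithBot.bot_lt_coe n)).2 ?_)
    exact fun i _ => (degree_C_mul_X_pow_le _ _).trans_lt (by exact_mod_cast i.2)
  constructor
  · rintro ⟨v, rfl⟩
    refine ⟨monic_X_pow_add (hlt v), ?_⟩
    rw [natDegree_eq_of_degree_eq_some (n := n)]
    rw [degree_add_eq_left_of_degree_lt] <;> simp [hlt v]
  · rintro ⟨hg, hn⟩
    refine ⟨fun i => g.coeff i, ?_⟩
    conv_rhs => rw [hg.as_sum, hn, ← Fin.sum_univ_eq_sum_range (fun i => C (g.coeff i) * X ^ i)]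

/-- The finite set of monic irreducible polynomials of degree `n` over a finite field. -/
noncomputable def monicIrreduciblesOfDegree (F : Type*) [Field F] [Fintype F] [DecidableEq F]
    (n : ℕ) : Finset F[X] :=
  letI := Classical.decPred (Irreducible : F[X] → Prop)
  (monicsOfDegree F n).filter Irreducible

theorem mem_monicIrreduciblesOfDegree {n : ℕ} {P : F[X]} :
    P ∈ monicIrreduciblesOfDegree F n ↔ P.Monic ∧ P.natDegree = n ∧ Irreducible P := by
  simp [monicIrreduciblesOfDegree, mem_monicsOfDegree, and_assoc]

theorem sum_monicIrreducibles_degree [DecidableRel ((· ∣ ·) : F[X] → F[X] → Prop)] {n : ℕ}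
    {g : F[X]} (hg : g ∈ monicsOfDegree F n) :
    ∑ i ∈ Icc 1 n, ∑ P ∈ monicIrreduciblesOfDegree F i, ∑ j ∈ Icc 1 n,
      (if P ^ j ∣ g then i else 0) = n := by
  classical
  obtain ⟨hgm, hgn⟩ := mem_monicsOfDegree.1 hg
  have hg0 := hgm.ne_zero
  have hfac {P : F[X]} : P ∈ UniqueFactorizationMonoid.normalizedFactors g ↔
      Irreducible P ∧ P.Monic ∧ P ∣ g := Polynomial.mem_normalizedFactors_iff hg0
  have hcount {P : F[X]} (hP : Irreducible P) (hPm : P.Monic) :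
      ∑ j ∈ Icc 1 n, (if P ^ j ∣ g then P.natDegree else 0) =
        (UniqueFactorizationMonoid.normalizedFactors g).count P * P.natDegree := by
    rw [← sum_filter, sum_const, smul_eq_mul]
    congr 1
    have h1 : ∀ j, P ^ j ∣ g ↔ j ≤ (UniqueFactorizationMonoid.normalizedFactors g).count P := by
      intro j
      have := UniqueFactorizationMonoid.emultiplicity_eq_count_normalizedFactors hP hg0
      rw [hPm.normalize_eq_self] at this
      rw [pow_dvd_iff_le_emultiplicity, this, Nat.cast_le]
    have h2 : (UniqueFactorizationMonoid.normalizedFactors g).count P ≤ n := by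
      have := natDegree_le_of_dvd ((h1 _).2 le_rfl) hg0
      rw [natDegree_pow, hgn] at this
      nlinarith [hP.natDegree_pos]
    have : (Icc 1 n).filter (fun j => P ^ j ∣ g) =
        Icc 1 ((UniqueFactorizationMonoid.normalizedFactors g).count P) := by
      ext j; simp only [mem_filter, mem_Icc, h1]; omega
    rw [this, Nat.card_Icc, Nat.add_sub_cancel]
  have hdeg : n = ((UniqueFactorizationMonoid.normalizedFactors g).map natDegree).sum := by
    rw [← natDegree_multiset_prod _ (UniqueFactorizationMonoid.zero_notMem_normalizedFactors g),
      ← hgn]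
    have := UniqueFactorizationMonoid.prod_normalizedFactors_eq (a := g) hg0
    rw [this, hgm.normalize_eq_self]
  conv_rhs => rw [hdeg, Finset.sum_multiset_map_count]
  rw [sum_sigma', sum_bij_ne_zero (fun (x : (_ : ℕ) × F[X]) _ _ => x.2)]
  · rintro ⟨i, P⟩ h1 h2
    simp only [mem_sigma, mem_Icc, mem_monicIrreduciblesOfDegree] at h1
    obtain ⟨-, hPm, rfl, hP⟩ := h1
    simp only at h2
    rw [hcount hP hPm] at h2
    rw [Multiset.mem_toFinset]
    exact Multiset.count_ne_zero.1 (left_ne_zero_of_mul h2)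
  · rintro ⟨i, P⟩ h1 - ⟨i', P'⟩ h1' - rfl
    simp only [mem_sigma, mem_monicIrreduciblesOfDegree] at h1 h1'
    rw [h1.2.2.1.symm.trans h1'.2.2.1]
  · intro P hP h
    rw [Multiset.mem_toFinset, hfac] at hP
    refine ⟨⟨P.natDegree, P⟩, ?_, ?_, rfl⟩
    · simp only [mem_sigma, mem_Icc, mem_monicIrreduciblesOfDegree]
      exact ⟨⟨hP.1.natDegree_pos, hgn ▸ natDegree_le_of_dvd hP.2.2 hg0⟩, hP.2.1, trivial, hP.1⟩
    · simpa only [hcount hP.1 hP.2.1, smul_eq_mul] using h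
  · rintro ⟨i, P⟩ h1 -
    simp only [mem_sigma, mem_Icc, mem_monicIrreduciblesOfDegree] at h1
    obtain ⟨-, hPm, rfl, hP⟩ := h1
    simp only [hcount hP hPm, smul_eq_mul]

/-- The logarithmic derivative of the Euler product of `∑ w(g) T ^ deg g`. -/
noncomputable def eulerPowerSum (w : F[X] →* ℂ) (k : ℕ) : ℂ :=
  ∑ x ∈ k.divisorsAntidiagonal, ∑ P ∈ monicIrreduciblesOfDegree F x.1, (x.1 : ℂ) * w P ^ x.2

theorem newton_identity (w : F[X] →* ℂ) (n : ℕ) :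
    (n : ℂ) * ∑ g ∈ monicsOfDegree F n, w g =
      ∑ k ∈ Icc 1 n, eulerPowerSum w k * ∑ g ∈ monicsOfDegree F (n - k), w g := by
  classical
  have h1 : (n : ℂ) * ∑ g ∈ monicsOfDegree F n, w g = ∑ i ∈ Icc 1 n, ∑ j ∈ Icc 1 n,
      ∑ P ∈ monicIrreduciblesOfDegree F i, ∑ g ∈ monicsOfDegree F n,
        if P ^ j ∣ g then (i : ℂ) * w g else 0 := by
    have : ∀ g ∈ monicsOfDegree F n, (n : ℂ) * w g = ∑ i ∈ Icc 1 n, ∑ j ∈ Icc 1 n,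
        ∑ P ∈ monicIrreduciblesOfDegree F i, if P ^ j ∣ g then (i : ℂ) * w g else 0 := by
      intro g hg
      conv_lhs => rw [← sum_monicIrreducibles_degree hg]
      push_cast
      simp only [sum_mul, ite_mul, zero_mul]
      exact sum_congr rfl fun i _ => sum_comm
    rw [mul_sum, sum_congr rfl this, sum_comm]
    refine sum_congr rfl fun i _ => ?_
    rw [sum_comm]
    exact sum_congr rfl fun j _ => sum_comm
  have h2 : ∀ i ∈ Icc 1 n, ∀ j ∈ Icc 1 n, ∀ P ∈ monicIrreduciblesOfDegree F i,
      (∑ g ∈ monicsOfDegree F n, if P ^ j ∣ g then (i : ℂ) * w g else 0) =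
        if i * j ≤ n then i * w P ^ j * ∑ g ∈ monicsOfDegree F (n - i * j), w g else 0 := by
    intro i _ j _ P hP
    obtain ⟨hPm, hPi, hPirr⟩ := mem_monicIrreduciblesOfDegree.1 hP
    have hPj : (P ^ j).natDegree = i * j := by rw [natDegree_pow, hPi, mul_comm]
    have hPjm := hPm.pow j
    rw [← sum_filter]
    split_ifs with hij
    · rw [mul_sum]
      symm
      refine sum_bij (fun g _ => P ^ j * g) ?_ ?_ ?_ ?_
      · intro g hg
        obtain ⟨hg1, hg2⟩ := mem_monicsOfDegree.1 hg
        refine mem_filter.2 ⟨mem_monicsOfDegree.2 ⟨hPjm.mul hg1, ?_⟩, dvd_mul_right _ _⟩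
        rw [hPjm.natDegree_mul hg1, hg2, hPj]; omega
      · intro g _ g' _ h
        exact mul_left_cancel₀ hPjm.ne_zero h
      · intro g hg
        obtain ⟨hg, g', rfl⟩ := mem_filter.1 hg
        obtain ⟨hg1, hg2⟩ := mem_monicsOfDegree.1 hg
        have hg'm := hPjm.of_mul_monic_left hg1
        refine ⟨g', mem_monicsOfDegree.2 ⟨hg'm, ?_⟩, rfl⟩
        rw [hPjm.natDegree_mul hg'm, hPj] at hg2; omega
      · intro g _
        rw [map_mul, map_pow]; ring
    · rw [filter_eq_empty_iff.2, sum_empty]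
      intro g hg hdvd
      obtain ⟨hg1, hg2⟩ := mem_monicsOfDegree.1 hg
      have := natDegree_le_of_dvd hdvd hg1.ne_zero
      omega
  rw [h1, sum_congr rfl fun i hi => sum_congr rfl fun j hj => sum_congr rfl (h2 i hi j hj)]
  simp only [eulerPowerSum, sum_mul]
  rw [← sum_product', sum_sigma' (Icc 1 n) (fun k => k.divisorsAntidiagonal)]
  rw [sum_congr rfl (g := fun x : ℕ × ℕ => if x.1 * x.2 ≤ n then
    ∑ P ∈ monicIrreduciblesOfDegree F x.1,
      (x.1 : ℂ) * w P ^ x.2 * ∑ g ∈ monicsOfDegree F (n - x.1 * x.2), w g else 0)]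
  swap
  · intro x _
    split_ifs <;> simp
  rw [← sum_filter]
  refine sum_bij (fun x _ => ⟨x.1 * x.2, x⟩) ?_ ?_ ?_ ?_
  · rintro ⟨i, j⟩ h
    simp only [mem_filter, mem_product, mem_Icc, mem_sigma, Nat.mem_divisorsAntidiagonal] at h ⊢
    have := Nat.mul_pos h.1.1.1 h.1.2.1
    simp only [true_and]; omega
  · rintro x _ y _ h
    simp only [Sigma.mk.injEq] at h
    exact eq_of_heq h.2
  · rintro ⟨k, i, j⟩ h
    simp only [mem_sigma, mem_Icc, Nat.mem_divisorsAntidiagonal] at h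
    obtain ⟨⟨h3, h4⟩, rfl, h5⟩ := h
    have hi := Nat.pos_of_ne_zero (left_ne_zero_of_mul h5)
    have hj := Nat.pos_of_ne_zero (right_ne_zero_of_mul h5)
    refine ⟨(i, j), ?_, rfl⟩
    simp only [mem_filter, mem_product, mem_Icc]
    refine ⟨⟨⟨hi, ?_⟩, ⟨hj, ?_⟩⟩, h4⟩ <;> nlinarith
  · rintro ⟨i, j⟩ _
    rfl
end

section
open IntermediateField
theorem norm_algebraMap_sub_eq {F E : Type*} [Field F] [Field E] [Algebra F E]
    [FiniteDimensional F E] (a : F) (x : E) :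
    Algebra.norm F (algebraMap F E a - x) =
      (minpoly F x).eval a ^ (Module.finrank F E / (minpoly F x).natDegree) := by
  have hx : IsIntegral F x := Algebra.IsIntegral.isIntegral x
  let pb := adjoin.powerBasis hx
  have h1 : Algebra.norm F (algebraMap F F⟮x⟯ a - pb.gen) = (minpoly F x).eval a := by
    rw [Algebra.norm_eq_matrix_det pb.basis, map_sub, AlgHom.commutes, ← minpoly_gen F x,
      ← adjoin.powerBasis_gen hx, ← charpoly_leftMulMatrix pb, Matrix.eval_charpoly]
    rfl
  have h2 : algebraMap F E a - x = algebraMap F⟮x⟯ E (algebraMap F F⟮x⟯ a - pb.gen) := by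
    rw [adjoin.powerBasis_gen hx, map_sub, ← IsScalarTower.algebraMap_apply,
      IntermediateField.algebraMap_apply,
      AdjoinSimple.coe_gen]
  rw [h2, ← Algebra.norm_norm (S := F⟮x⟯),
    Algebra.norm_algebraMap_of_basis (Module.Free.chooseBasis F⟮x⟯ E),
    map_pow, h1, ← Module.finrank_eq_card_chooseBasisIndex]
  congr 1
  rw [← adjoin.finrank hx]
  exact (Nat.div_eq_of_eq_mul_right Module.finrank_pos (Module.finrank_mul_finrank _ _ _).symm).symm
end

section
variable {F : Type*} [Field F] [Fintype F] [DecidableEq F]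

theorem eulerPowerSum_finrank {E : Type*} [Field E] [Fintype E] [Algebra F E] (w : F[X] →* ℂ) :
    eulerPowerSum w (Module.finrank F E) =
      ∑ x : E, w (minpoly F x) ^ (Module.finrank F E / (minpoly F x).natDegree) := by
  classical
  set k := Module.finrank F E with hk
  have hk0 : k ≠ 0 := Module.finrank_pos.ne'
  have hint (x : E) : IsIntegral F x := Algebra.IsIntegral.isIntegral x
  have hroots {P : F[X]} (hP : Irreducible P) (hPm : P.Monic) (hdvd : P.natDegree ∣ k) :
      #{x : E | minpoly F x = P} = P.natDegree := by
    have hsplit : (P.map (algebraMap F E)).Splits := by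
      have hX := hP.natDegree_dvd_iff_dvd_X_pow_card_pow_sub_X.1 hdvd
      refine Splits.of_dvd ?_ ?_ (Polynomial.map_dvd (algebraMap F E) hX)
      · have := FiniteField.isSplittingField_sub E F
        rw [show Nat.card F ^ k = Fintype.card E by
          rw [Nat.card_eq_fintype_card, ← Module.card_eq_pow_finrank]]
        exact this.splits
      · refine (Polynomial.map_ne_zero_iff (algebraMap F E).injective).2 ?_
        exact FiniteField.X_pow_card_pow_sub_X_ne_zero _ hk0 Finite.one_lt_card
    have hcard := card_rootSet_eq_natDegree (PerfectField.separable_of_irreducible hP) hsplit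
    rw [← hcard, ← Set.toFinset_card]
    congr 1
    ext x
    simp only [mem_filter, mem_univ, true_and, Set.mem_toFinset,
      mem_rootSet_of_ne hPm.ne_zero]
    constructor
    · rintro rfl; exact minpoly.aeval _ _
    · intro h; exact (minpoly.eq_of_irreducible_of_monic hP h hPm).symm
  rw [eulerPowerSum]
  have h1 : ∀ x : E, ((minpoly F x).natDegree, k / (minpoly F x).natDegree) ∈
      k.divisorsAntidiagonal := by
    intro x
    rw [Nat.mem_divisorsAntidiagonal]
    refine ⟨Nat.mul_div_cancel' ?_, hk0⟩
    exact minpoly.degree_dvd (hint x)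
  rw [← sum_fiberwise_of_maps_to (s := univ) (t := k.divisorsAntidiagonal)
    (g := fun x : E => ((minpoly F x).natDegree, k / (minpoly F x).natDegree)) (fun x _ => h1 x)]
  refine sum_congr rfl ?_
  rintro ⟨i, j⟩ hij
  rw [Nat.mem_divisorsAntidiagonal] at hij
  have hi : 0 < i := Nat.pos_of_ne_zero (left_ne_zero_of_mul (hij.1.trans_ne hij.2))
  symm
  rw [← sum_fiberwise_of_maps_to (t := monicIrreduciblesOfDegree F i) (g := fun x => minpoly F x)]
  · refine sum_congr rfl fun P hP => ?_
    obtain ⟨hPm, rfl, hPirr⟩ := mem_monicIrreduciblesOfDegree.1 hP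
    have hj : k / P.natDegree = j := by
      rw [← hij.1]; exact Nat.mul_div_cancel_left _ hi
    have hset : (univ.filter fun x : E => ((minpoly F x).natDegree, k / (minpoly F x).natDegree) =
        (P.natDegree, j) ∧ minpoly F x = P) = univ.filter fun x : E => minpoly F x = P := by
      ext x
      simp only [mem_filter, mem_univ, true_and, Prod.mk.injEq]
      constructor
      · exact fun h => h.2
      · rintro rfl; exact ⟨⟨rfl, hj⟩, rfl⟩
    rw [filter_filter, hset, sum_congr rfl (g := fun _ => w P ^ j), sum_const,
      hroots hPirr hPm ⟨j, hij.1.symm⟩, nsmul_eq_mul]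
    intro x hx
    rw [mem_filter] at hx
    rw [hx.2, hj]
  · intro x hx
    simp only [mem_filter, mem_univ, true_and, Prod.mk.injEq] at hx
    exact mem_monicIrreduciblesOfDegree.2
      ⟨minpoly.monic (hint x), hx.1, minpoly.irreducible (hint x)⟩
end

/-- If the power sums of two complex numbers are bounded, both lie in the closed unit disc. -/
theorem norm_le_one_of_pow_add_pow_bounded {u v : ℂ} {C : ℝ} {s₀ : ℕ}
    (h : ∀ s ≥ s₀, ‖u ^ s + v ^ s‖ ≤ C) : ‖u‖ ≤ 1 := by
  by_contra! hu
  have hC : 0 ≤ C := (norm_nonneg _).trans (h s₀ le_rfl)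
  obtain ⟨s, hs, hs1⟩ := ((Filter.eventually_ge_atTop s₀).and
    ((tendsto_pow_atTop_atTop_of_one_lt hu).eventually_gt_atTop (C + (C ^ 2 + C) + 1))).exists
  have h1 := h s hs
  have h2 := h (s * 2) (by omega)
  have huv : ‖(u * v) ^ s‖ ≤ C ^ 2 + C := by
    have e : (u * v) ^ s = ((u ^ s + v ^ s) ^ 2 - (u ^ (s * 2) + v ^ (s * 2))) / 2 := by
      rw [pow_mul, pow_mul, mul_pow]; ring
    have : ‖(u ^ s + v ^ s) ^ 2 - (u ^ (s * 2) + v ^ (s * 2))‖ ≤ C ^ 2 + C := by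
      refine (norm_sub_le _ _).trans (add_le_add ?_ h2)
      rw [norm_pow]; gcongr
    rw [e, norm_div, Complex.norm_ofNat]
    linarith [norm_nonneg ((u ^ s + v ^ s) ^ 2 - (u ^ (s * 2) + v ^ (s * 2)))]
  have e : u ^ s * u ^ s = u ^ s * (u ^ s + v ^ s) - (u * v) ^ s := by rw [mul_pow]; ring
  have h3 : ‖u‖ ^ s * ‖u‖ ^ s ≤ ‖u‖ ^ s * C + (C ^ 2 + C) := by
    rw [← norm_pow, ← norm_mul, e]
    refine (norm_sub_le _ _).trans (add_le_add ?_ huv)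
    rw [norm_mul]; gcongr
  nlinarith [sq_nonneg C]

/-- A sequence satisfying Newton's identities for a polynomial `1 + c₁ T + c₂ T ^ 2` and of size
`O(q ^ (n / 2))` along the even integers has first term at most `2 √q`. -/
theorem norm_le_of_newton_recurrence {S : ℕ → ℂ} {c₁ c₂ : ℂ} (h1 : S 1 = c₁)
    (h2 : S 2 + S 1 * c₁ = 2 * c₂)
    (hrec : ∀ n, S (n + 3) + S (n + 2) * c₁ + S (n + 1) * c₂ = 0)
    {q C : ℝ} (hq : 0 < q) {s₀ : ℕ} (hS : ∀ s ≥ s₀, ‖S (2 * s)‖ ≤ C * q ^ s) :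
    ‖S 1‖ ≤ 2 * √q := by
  obtain ⟨r, hr⟩ := IsAlgClosed.exists_pow_nat_eq (c₁ ^ 2 - 4 * c₂) two_pos
  obtain ⟨α, hα⟩ : ∃ α, α = (-c₁ + r) / 2 := ⟨_, rfl⟩
  obtain ⟨β, hβ⟩ : ∃ β, β = (-c₁ - r) / 2 := ⟨_, rfl⟩
  have e1 : c₁ = -(α + β) := by rw [hα, hβ]; ring
  have e2 : c₂ = α * β := by rw [hα, hβ]; linear_combination (1 / 4) * hr
  have hpow : ∀ n, S (n + 1) = -(α ^ (n + 1) + β ^ (n + 1)) ∧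
      S (n + 2) = -(α ^ (n + 2) + β ^ (n + 2)) := by
    intro n
    induction n with
    | zero =>
      refine ⟨by rw [h1, e1]; ring, ?_⟩
      rw [h1, e1, e2] at h2; linear_combination h2
    | succ n ih =>
      refine ⟨ih.2, ?_⟩
      have := hrec n
      rw [ih.1, ih.2, e1, e2] at this
      linear_combination this
  have hbound : ∀ s ≥ s₀ + 1, ‖(α ^ 2 / q) ^ s + (β ^ 2 / q) ^ s‖ ≤ C := by
    intro s hs
    obtain ⟨n, hn⟩ : ∃ n, 2 * s = n + 1 := ⟨2 * s - 1, by omega⟩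
    have h3 := hS s (by omega)
    rw [hn, (hpow n).1, norm_neg, ← hn] at h3
    rw [div_pow (α ^ 2), div_pow (β ^ 2), ← add_div, norm_div, ← pow_mul, ← pow_mul, norm_pow,
      Complex.norm_real,
      Real.norm_of_nonneg hq.le, div_le_iff₀ (by positivity)]
    exact h3
  have hle {z : ℂ} (hz : ‖z ^ 2 / q‖ ≤ 1) : ‖z‖ ≤ √q := by
    rw [norm_div, norm_pow, Complex.norm_real, Real.norm_of_nonneg hq.le, div_le_one hq] at hz
    exact Real.le_sqrt_of_sq_le hz
  have hA := hle (norm_le_one_of_pow_add_pow_bounded hbound)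
  have hB := hle (norm_le_one_of_pow_add_pow_bounded (u := β ^ 2 / q) (v := α ^ 2 / q)
    fun s hs => by rw [add_comm]; exact hbound s hs)
  rw [h1, e1, norm_neg]
  linarith [norm_add_le α β]

section
variable {p : ℕ} [Fact p.Prime]

/-- The character `g ↦ χ (g(0) g(a) ^ m g(b) ^ n)` of the monoid of polynomials. -/
noncomputable def evalChar (χ : MulChar (ZMod p) ℂ) (a b : ZMod p) (m n : ℕ) :
    (ZMod p)[X] →* ℂ where
  toFun g := χ (g.eval 0 * g.eval a ^ m * g.eval b ^ n)
  map_one' := by simp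
  map_mul' f g := by simp only [eval_mul, mul_pow, map_mul]; ring

theorem sum_evalChar_eq_zero {χ : MulChar (ZMod p) ℂ} (hχ : χ ≠ 1) {a b : ZMod p} (ha : a ≠ 0)
    (hb : b ≠ 0) (m n : ℕ) {k : ℕ} (hk : 3 ≤ k) :
    ∑ g ∈ monicsOfDegree (ZMod p) k, evalChar χ a b m n g = 0 := by
  set Z := ∑ g ∈ monicsOfDegree (ZMod p) k, evalChar χ a b m n g with hZ
  let u : (ZMod p)[X] := (X - C a) * (X - C b)
  have hu (t : ZMod p) : (C t * u).natDegree < k := by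
    refine (natDegree_C_mul_le _ _).trans_lt (natDegree_mul_le.trans_lt ?_)
    rw [natDegree_X_sub_C, natDegree_X_sub_C]; omega
  have hmem (t : ZMod p) {g} (hg : g ∈ monicsOfDegree (ZMod p) k) :
      g + C t * u ∈ monicsOfDegree (ZMod p) k := by
    obtain ⟨h1, h2⟩ := mem_monicsOfDegree.1 hg
    refine mem_monicsOfDegree.2 ⟨h1.add_of_left (degree_lt_degree (h2 ▸ hu t)), ?_⟩
    rw [natDegree_add_eq_left_of_natDegree_lt (h2 ▸ hu t), h2]
  have hshift (t : ZMod p) :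
      Z = ∑ g ∈ monicsOfDegree (ZMod p) k, evalChar χ a b m n (g + C t * u) := by
    refine (sum_bij (fun g _ => g + C t * u) (fun g hg => hmem t hg)
      (fun _ _ _ _ h => add_right_cancel h) (fun g hg => ⟨g + C (-t) * u, hmem _ hg, ?_⟩)
      (fun _ _ => rfl)).symm
    rw [C_neg]; ring
  have hsum : (p : ℂ) * Z = 0 := by
    calc (p : ℂ) * Z = ∑ t : ZMod p, Z := by simp [ZMod.card]
      _ = ∑ t : ZMod p, ∑ g ∈ monicsOfDegree (ZMod p) k, evalChar χ a b m n (g + C t * u) :=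
        sum_congr rfl fun t _ => hshift t
      _ = ∑ g ∈ monicsOfDegree (ZMod p) k, ∑ t : ZMod p, evalChar χ a b m n (g + C t * u) :=
        sum_comm
      _ = 0 := sum_eq_zero fun g _ => by
        have : ∀ t, evalChar χ a b m n (g + C t * u) =
            χ (g.eval 0 + t * (a * b)) * χ (g.eval a ^ m * g.eval b ^ n) := by
          intro t
          simp [evalChar, u, mul_assoc]
        simp only [this]
        rw [← sum_mul]
        have hb : Function.Bijective fun t : ZMod p => g.eval 0 + t * (a * b) :=
          ((mulRight_bijective₀ _ (mul_ne_zero ha hb)).comp Function.bijective_id |>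
            (AddGroup.addLeft_bijective (g.eval 0)).comp)
        rw [hb.sum_comp (fun t => χ t), MulChar.sum_eq_zero_of_ne_one hχ, zero_mul]
  exact (mul_eq_zero.1 hsum).resolve_left (by exact_mod_cast (Fact.out : p.Prime).ne_zero)

theorem norm_eulerPowerSum_evalChar_le {χ : MulChar (ZMod p) ℂ} (hχ : χ ≠ 1) {a b : ZMod p}
    (ha : a ≠ 0) (hb : b ≠ 0) (m n : ℕ) (hp : 3 ≤ p) {s : ℕ} (hs : 1 ≤ s) :
    ‖eulerPowerSum (evalChar χ a b m n) (2 * s)‖ ≤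
      (2 * (p - 1) * (2 * (m + n) + 2) + 3) * (p : ℝ) ^ s := by
  classical
  let E := GaloisField p (2 * s)
  have : Fintype E := Fintype.ofFinite E
  have hfin : Module.finrank (ZMod p) E = 2 * s := GaloisField.finrank p (by omega)
  set M := p ^ s with hM
  have hcard : Fintype.card E = M ^ 2 := by
    rw [← Nat.card_eq_fintype_card, GaloisField.card p _ (by omega), hM, ← pow_mul, mul_comm]
  have hM1 : 1 < M := Nat.one_lt_pow (by omega) (by omega)
  obtain ⟨L, hL⟩ : p - 1 ∣ M - 1 := by simpa using Nat.sub_dvd_pow_sub_pow p 1 s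
  have hMd : M = (p - 1) * L + 1 := by omega
  have hL1 : 1 ≤ L := by
    rcases Nat.eq_zero_or_pos L with rfl | h
    · omega
    · exact h
  let φ := algebraMap (ZMod p) E
  let f : E → E := fun x => (φ 0 - x) * (φ a - x) ^ m * (φ b - x) ^ n
  let h : E[X] := -((C (φ a) - X) ^ m * (C (φ b) - X) ^ n)
  have hfh (x : E) : f x = x * h.eval x := by simp [f, h]; ring
  have hh0 : h.coeff 0 ≠ 0 := by
    rw [coeff_zero_eq_eval_zero]
    simp [h, φ, ha, hb]
  have hhdeg : h.natDegree ≤ m + n := by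
    have (c : E) : (C c - X).natDegree ≤ 1 := by
      rw [← neg_sub, natDegree_neg, natDegree_X_sub_C]
    simp only [h, natDegree_neg]
    refine natDegree_mul_le.trans (add_le_add ?_ ?_) <;>
    exact natDegree_pow_le.trans ((Nat.mul_le_mul_left _ (this _)).trans (mul_one _).le)
  let N : ZMod p → ℕ := fun ζ => #{x : E | Algebra.norm (ZMod p) (f x) = ζ}
  have hN {ζ : ZMod p} (hζ : ζ ≠ 0) : N ζ ≤ (L + (2 * (m + n) + 2)) * M := by
    refine le_trans (card_le_card fun x hx => ?_)
      (stepanov_card_le p (by omega : 2 ≤ p - 1) hL1 hM hMd hcard h hh0 hhdeg (φ ζ)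
        ((map_ne_zero φ).2 hζ))
    simp only [mem_filter, mem_univ, true_and] at hx ⊢
    rw [← hfh, ← hx, FiniteField.algebraMap_norm_eq_pow, Nat.card_eq_fintype_card, hcard,
      Nat.card_eq_fintype_card, ZMod.card]
    congr 1
    symm
    refine Nat.div_eq_of_eq_mul_right (by omega) ?_
    rw [hMd]
    simp only [Nat.pow_succ, Nat.pow_zero]
    refine Nat.sub_eq_of_eq_add ?_
    ring
  have hN0 : N 0 ≤ 3 := by
    refine (card_le_card (t := {φ 0, φ a, φ b}) fun x hx => ?_).trans card_le_three
    simp only [mem_filter, mem_univ, true_and, Algebra.norm_eq_zero_iff] at hx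
    simp only [f, mul_eq_zero, pow_eq_zero_iff', sub_eq_zero] at hx
    simp only [mem_insert, mem_singleton]
    tauto
  have hNsum : ∑ ζ, N ζ = M ^ 2 := by
    rw [← hcard, ← card_univ, ← card_eq_sum_card_fiberwise (fun _ _ => mem_univ _)]
  have hS : eulerPowerSum (evalChar χ a b m n) (2 * s) = ∑ ζ, χ ζ * N ζ := by
    rw [← hfin, eulerPowerSum_finrank]
    rw [← sum_fiberwise_of_maps_to (t := univ) (g := fun x => Algebra.norm (ZMod p) (f x))
      (fun _ _ => mem_univ _)]
    refine sum_congr rfl fun ζ _ => ?_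
    rw [sum_congr rfl (g := fun _ => χ ζ), sum_const, nsmul_eq_mul, mul_comm]
    intro x hx
    rw [mem_filter] at hx
    rw [← hx.2]
    simp only [f, φ, map_mul, map_pow, norm_algebraMap_sub_eq]
    simp only [evalChar, MonoidHom.coe_mk, OneHom.coe_mk, map_mul, map_pow]
    ring
  have hS' : eulerPowerSum (evalChar χ a b m n) (2 * s) =
      ∑ ζ ∈ univ.erase (0 : ZMod p), χ ζ * ((N ζ : ℝ) - L * M : ℝ) := by
    rw [hS, ← sum_erase univ (a := (0 : ZMod p)) (by rw [MulChar.map_zero, zero_mul])]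
    have : ∑ ζ ∈ univ.erase (0 : ZMod p), χ ζ = 0 := by
      rw [sum_erase _ (MulChar.map_zero χ), MulChar.sum_eq_zero_of_ne_one hχ]
    push_cast
    simp only [mul_sub, sum_sub_distrib]
    rw [← sum_mul, this]; simp
  have hcard' : (#(univ.erase (0 : ZMod p)) : ℝ) = p - 1 := by
    rw [card_erase_of_mem (mem_univ _), card_univ, ZMod.card, Nat.cast_sub (by omega), Nat.cast_one]
  have hMp : (M : ℝ) = (p : ℝ) ^ s := by rw [hM]; push_cast; rfl
  have hMd' : (M : ℝ) = (p - 1) * L + 1 := by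
    rw [hMd]; push_cast [Nat.cast_sub (by omega : 1 ≤ p)]; ring
  have hNsum' : ∑ ζ ∈ univ.erase (0 : ZMod p), (N ζ : ℝ) = (M : ℝ) ^ 2 - N 0 := by
    rw [eq_sub_iff_add_eq, sum_erase_add _ _ (mem_univ _)]
    exact_mod_cast hNsum
  have hM1' : (1 : ℝ) < M := by exact_mod_cast hM1
  rw [hS', ← hMp]
  set U : ℝ := (2 * (m + n) + 2) * M with hU
  have hU0 : 0 ≤ U := by positivity
  calc _ ≤ ∑ ζ ∈ univ.erase (0 : ZMod p), ‖χ ζ * ((N ζ : ℝ) - L * M : ℝ)‖ := norm_sum_le _ _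
    _ ≤ ∑ ζ ∈ univ.erase (0 : ZMod p), (2 * U - ((N ζ : ℝ) - L * M)) := by
      refine sum_le_sum fun ζ hζ => ?_
      have hn : (N ζ : ℝ) ≤ (L + (2 * (m + n) + 2)) * M := by exact_mod_cast hN (ne_of_mem_erase hζ)
      rw [norm_mul, Complex.norm_real, Real.norm_eq_abs]
      have h1 : ‖χ ζ‖ ≤ 1 := DirichletCharacter.norm_le_one χ ζ
      refine (mul_le_of_le_one_left (abs_nonneg _) h1).trans ?_
      rw [abs_le]; constructor <;> nlinarith
    _ = 2 * (p - 1) * U + N 0 - M := by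
      rw [sum_sub_distrib, sum_sub_distrib, hNsum', sum_const, sum_const, nsmul_eq_mul,
        nsmul_eq_mul, hcard', sq]
      conv_lhs => enter [2, 1, 1, 1]; rw [hMd']
      ring
    _ ≤ _ := by
      have : (N 0 : ℝ) ≤ 3 := by exact_mod_cast hN0
      rw [hU]; nlinarith

/-- Weil's bound for a multiplicative character sum with at most three finite zeros and poles. -/
theorem norm_sum_mulChar_le {χ : MulChar (ZMod p) ℂ} (hχ : χ ≠ 1) {a b : ZMod p}
    (ha : a ≠ 0) (hb : b ≠ 0) (m n : ℕ) (hp : 3 ≤ p) :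
    ‖∑ x : ZMod p, χ ((0 - x) * (a - x) ^ m * (b - x) ^ n)‖ ≤ 2 * √p := by
  set w := evalChar χ a b m n with hw
  set c : ℕ → ℂ := fun k => ∑ g ∈ monicsOfDegree (ZMod p) k, w g with hc
  have hc0 : c 0 = 1 := by
    have : monicsOfDegree (ZMod p) 0 = {1} := by
      ext g
      rw [mem_monicsOfDegree, mem_singleton]
      exact ⟨fun h => (Monic.natDegree_eq_zero h.1).1 h.2, by rintro rfl; simp⟩
    simp [hc, this]
  have hc3 : ∀ k, 3 ≤ k → c k = 0 := fun k hk => sum_evalChar_eq_zero hχ ha hb m n hk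
  have hnewton := newton_identity w
  have hS1 : eulerPowerSum w 1 = ∑ x : ZMod p, χ ((0 - x) * (a - x) ^ m * (b - x) ^ n) := by
    have h1 : monicIrreduciblesOfDegree (ZMod p) 1 = univ.image fun x : ZMod p => X - C x := by
      ext P
      simp only [mem_monicIrreduciblesOfDegree, mem_image, mem_univ, true_and]
      constructor
      · rintro ⟨hm, hd, -⟩
        refine ⟨-P.coeff 0, ?_⟩
        rw [C_neg, sub_neg_eq_add]
        exact (hm.eq_X_add_C hd).symm
      · rintro ⟨x, rfl⟩
        exact ⟨monic_X_sub_C x, natDegree_X_sub_C x, irreducible_X_sub_C x⟩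
    simp only [eulerPowerSum, Nat.divisorsAntidiagonal_one, sum_singleton, h1, Nat.cast_one,
      one_mul, pow_one]
    rw [sum_image fun x _ y _ h => by simpa using h]
    refine sum_congr rfl fun x _ => ?_
    simp only [hw, evalChar, MonoidHom.coe_mk, OneHom.coe_mk, eval_sub, eval_X, eval_C]
  have h1 : eulerPowerSum w 1 = c 1 := by
    have := hnewton 1
    change ((1 : ℕ) : ℂ) * c 1 = ∑ k ∈ Icc 1 1, eulerPowerSum w k * c (1 - k) at this
    simpa [hc0] using this.symm
  have h2 : eulerPowerSum w 2 + eulerPowerSum w 1 * c 1 = 2 * c 2 := by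
    have := hnewton 2
    change ((2 : ℕ) : ℂ) * c 2 = ∑ k ∈ Icc 1 2, eulerPowerSum w k * c (2 - k) at this
    rw [show Icc 1 2 = {1, 2} from rfl, sum_pair (by norm_num)] at this
    simp only [Nat.sub_self, hc0, Nat.cast_ofNat] at this
    rw [this]; ring
  have hrec : ∀ k, eulerPowerSum w (k + 3) + eulerPowerSum w (k + 2) * c 1 +
      eulerPowerSum w (k + 1) * c 2 = 0 := by
    intro k
    have := hnewton (k + 3)
    change ((k + 3 : ℕ) : ℂ) * c (k + 3) =
      ∑ i ∈ Icc 1 (k + 3), eulerPowerSum w i * c (k + 3 - i) at this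
    rw [hc3 _ (by omega), mul_zero, sum_Icc_succ_top (by omega), sum_Icc_succ_top (by omega),
      sum_Icc_succ_top (by omega), sum_eq_zero] at this
    · rw [show k + 3 - (k + 1) = 2 by omega, show k + 3 - (k + 2) = 1 by omega,
        show k + 3 - (k + 2 + 1) = 0 by omega, hc0] at this
      rw [show k + 3 = k + 2 + 1 from rfl]
      linear_combination -this
    · intro i hi
      rw [mem_Icc] at hi
      rw [hc3 _ (by omega), mul_zero]
  rw [← hS1]
  exact norm_le_of_newton_recurrence h1 h2 hrec (by exact_mod_cast (Fact.out : p.Prime).pos)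
    (fun s hs => norm_eulerPowerSum_evalChar_le hχ ha hb m n hp hs)
end

section
variable {p : ℕ} [Fact p.Prime]

theorem ZMod.inv_eq_pow_sub_two (hp : 3 ≤ p) (z : ZMod p) : z⁻¹ = z ^ (p - 2) := by
  rcases eq_or_ne z 0 with rfl | hz
  · rw [inv_zero, zero_pow (by omega)]
  · refine inv_eq_of_mul_eq_one_right ?_
    rw [← pow_succ', show p - 2 + 1 = p - 1 by omega, ZMod.pow_card_sub_one_eq_one hz]

theorem exists_mulChar_affine_eq (χ : MulChar (ZMod p) ℂ) {γ : ZMod p} (hγ : γ ≠ 1) (k : ℕ) :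
    ∃ a ≠ 0, ∃ m : ℕ, ∃ κ : ℂ, ‖κ‖ ≤ 1 ∧
      ∀ y, χ ((1 - γ - γ * y) ^ k) = κ * χ ((a - y) ^ m) := by
  rcases eq_or_ne γ 0 with rfl | h0
  · exact ⟨1, one_ne_zero, 0, 1, by simp, by simp⟩
  · refine ⟨(1 - γ) / γ, div_ne_zero (sub_ne_zero.2 hγ.symm) h0, k, χ (γ ^ k),
      DirichletCharacter.norm_le_one χ _, fun y => ?_⟩
    rw [← map_mul, ← mul_pow, mul_sub, mul_div_cancel₀ _ h0]

theorem norm_sum_mulChar_three_le {χ : MulChar (ZMod p) ℂ} (hχ : χ ≠ 1) (hp : 3 ≤ p)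
    {c₁ c₂ c₃ : ZMod p} (h1 : c₁ ≠ 0) (h2 : c₂ ≠ c₁) (h3 : c₃ ≠ c₁) :
    ‖∑ t : ZMod p, χ ((1 + c₁ * t) * (1 + c₂ * t) * (1 + c₃ * t)⁻¹)‖ ≤ 2 * √p := by
  have hne {c : ZMod p} (h : c ≠ c₁) : c / c₁ ≠ 1 := by rwa [Ne, div_eq_one_iff_eq h1]
  obtain ⟨a, ha, m, κ, hκ, hm⟩ := exists_mulChar_affine_eq χ (hne h2) 1
  obtain ⟨b, hb, n, μ, hμ, hn⟩ := exists_mulChar_affine_eq χ (hne h3) (p - 2)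
  have hbij : Function.Bijective fun y : ZMod p => (-y - 1) / c₁ := by
    refine ⟨fun x y h => ?_, fun t => ⟨-(c₁ * t) - 1, ?_⟩⟩
    · simpa [div_left_inj' h1] using h
    · field_simp; ring
  rw [← hbij.sum_comp]
  have : ∀ y : ZMod p, χ ((1 + c₁ * ((-y - 1) / c₁)) * (1 + c₂ * ((-y - 1) / c₁)) *
      (1 + c₃ * ((-y - 1) / c₁))⁻¹) = κ * μ * χ ((0 - y) * (a - y) ^ m * (b - y) ^ n) := by
    intro y
    have e (c : ZMod p) : 1 + c * ((-y - 1) / c₁) = 1 - c / c₁ - c / c₁ * y := by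
      field_simp; ring
    rw [e c₂, e c₃, ZMod.inv_eq_pow_sub_two hp, map_mul, map_mul, hn, ← pow_one (1 - c₂ / c₁ - _),
      hm, map_mul, map_mul, show 1 + c₁ * ((-y - 1) / c₁) = 0 - y by field_simp; ring]
    ring
  rw [sum_congr rfl fun y _ => this y, ← mul_sum, norm_mul, norm_mul]
  have h := norm_sum_mulChar_le hχ ha hb m n hp
  have : ‖κ‖ * ‖μ‖ ≤ 1 := mul_le_one₀ hκ (norm_nonneg _) hμ
  exact (mul_le_of_le_one_left (norm_nonneg _) this).trans h

/-- The correlation sum of a character at four shifts. -/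
noncomputable def fourCorrelation (χ : MulChar (ZMod p) ℂ) (b₁ b₂ b₃ b₄ : ZMod p) : ℂ :=
  ∑ x, χ ((x + b₁) * (x + b₂) * ((x + b₃)⁻¹ * (x + b₄)⁻¹))

theorem norm_fourCorrelation_le_of_ne {χ : MulChar (ZMod p) ℂ} (hχ : χ ≠ 1) (hp : 3 ≤ p)
    {b₁ b₂ b₃ b₄ : ZMod p} (h2 : b₂ ≠ b₁) (h3 : b₃ ≠ b₁) (h4 : b₄ ≠ b₁) :
    ‖fourCorrelation χ b₁ b₂ b₃ b₄‖ ≤ 2 * √p + 1 := by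
  have key : fourCorrelation χ b₁ b₂ b₃ b₄ = ∑ t : ZMod p,
      χ ((1 + (b₁ - b₄) * t) * (1 + (b₂ - b₄) * t) * (1 + (b₃ - b₄) * t)⁻¹) - 1 := by
    have e : fourCorrelation χ b₁ b₂ b₃ b₄ = ∑ t : ZMod p, χ ((t⁻¹ + (b₁ - b₄)) *
        (t⁻¹ + (b₂ - b₄)) * ((t⁻¹ + (b₃ - b₄))⁻¹ * t)) := by
      have hbij : Function.Bijective fun t : ZMod p => t⁻¹ - b₄ :=
        (Equiv.subRight b₄).bijective.comp inv_involutive.bijective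
      rw [fourCorrelation, ← hbij.sum_comp]
      refine sum_congr rfl fun t _ => ?_
      congr 1
      simp only [sub_add_cancel, inv_inv, sub_add_eq_add_sub, add_sub_assoc]
    rw [e, ← sum_erase univ (a := (0 : ZMod p))
      (by rw [mul_zero, mul_zero, MulChar.map_zero]), eq_sub_iff_add_eq,
      ← sum_erase_add univ _ (mem_univ (0 : ZMod p))]
    congr 1
    · refine sum_congr rfl fun t ht => ?_
      have ht : t ≠ 0 := ne_of_mem_erase ht
      congr 1
      have (c : ZMod p) : t⁻¹ + c = (1 + c * t) * t⁻¹ := by field_simp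
      rw [this, this, this, mul_inv, inv_inv]
      field_simp
    · simp
  rw [key]
  refine (norm_sub_le _ _).trans (add_le_add ?_ (by simp))
  exact norm_sum_mulChar_three_le hχ hp (sub_ne_zero.2 h4.symm) (by simpa using h2)
    (by simpa using h3)

theorem norm_fourCorrelation_inv (χ : MulChar (ZMod p) ℂ) (b₁ b₂ b₃ b₄ : ZMod p) :
    ‖fourCorrelation χ b₃ b₄ b₁ b₂‖ = ‖fourCorrelation χ b₁ b₂ b₃ b₄‖ := by
  rw [← norm_star, fourCorrelation, fourCorrelation, star_sum]
  congr 1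
  refine sum_congr rfl fun x _ => ?_
  rw [← MulChar.star_apply, MulChar.star_eq_inv, MulChar.inv_apply']
  congr 1
  simp only [mul_inv, inv_inv]
  ring

theorem norm_fourCorrelation_le {χ : MulChar (ZMod p) ℂ} (hχ : χ ≠ 1) (hp : 3 ≤ p)
    (b₁ b₂ b₃ b₄ : ZMod p) :
    ‖fourCorrelation χ b₁ b₂ b₃ b₄‖ ≤ (2 * √p + 1) +
      ((if b₁ = b₃ ∧ b₂ = b₄ then (p : ℝ) else 0) + (if b₁ = b₄ ∧ b₂ = b₃ then (p : ℝ) else 0) +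
        (if b₁ = b₂ ∧ b₃ = b₄ then (p : ℝ) else 0)) := by
  have htriv : ‖fourCorrelation χ b₁ b₂ b₃ b₄‖ ≤ p := by
    refine (norm_sum_le _ _).trans ((sum_le_sum fun x _ =>
      DirichletCharacter.norm_le_one χ _).trans ?_)
    simp [ZMod.card]
  have hsymm12 (b₁ b₂ b₃ b₄ : ZMod p) :
      fourCorrelation χ b₂ b₁ b₃ b₄ = fourCorrelation χ b₁ b₂ b₃ b₄ :=
    sum_congr rfl fun x _ => by rw [mul_comm (x + b₂)]
  have hp0 : (0 : ℝ) ≤ p := Nat.cast_nonneg p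
  have hs : 0 ≤ √(p : ℝ) := Real.sqrt_nonneg _
  by_cases hbad : (b₁ = b₃ ∧ b₂ = b₄) ∨ (b₁ = b₄ ∧ b₂ = b₃) ∨ (b₁ = b₂ ∧ b₃ = b₄)
  · split_ifs <;> first | linarith | tauto
  · have hgood : ‖fourCorrelation χ b₁ b₂ b₃ b₄‖ ≤ 2 * √p + 1 := by
      have : (b₂ ≠ b₁ ∧ b₃ ≠ b₁ ∧ b₄ ≠ b₁) ∨ (b₁ ≠ b₂ ∧ b₃ ≠ b₂ ∧ b₄ ≠ b₂) ∨
          (b₄ ≠ b₃ ∧ b₁ ≠ b₃ ∧ b₂ ≠ b₃) ∨ (b₃ ≠ b₄ ∧ b₁ ≠ b₄ ∧ b₂ ≠ b₄) := by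
        grind
      rcases this with h | h | h | h
      · exact norm_fourCorrelation_le_of_ne hχ hp h.1 h.2.1 h.2.2
      · rw [← hsymm12]
        exact norm_fourCorrelation_le_of_ne hχ hp h.1 h.2.1 h.2.2
      · rw [← norm_fourCorrelation_inv]
        exact norm_fourCorrelation_le_of_ne hχ hp h.1 h.2.1 h.2.2
      · rw [← norm_fourCorrelation_inv, ← hsymm12]
        exact norm_fourCorrelation_le_of_ne hχ hp h.1 h.2.1 h.2.2
    split_ifs <;> linarith

/-- The fourth moment of short character sums. -/
theorem sum_norm_sum_mulChar_pow_four_le {χ : MulChar (ZMod p) ℂ} (hχ : χ ≠ 1) (hp : 3 ≤ p)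
    (s : Finset (ZMod p)) :
    ∑ x, ‖∑ b ∈ s, χ (x + b)‖ ^ 4 ≤ 3 * (#s : ℝ) ^ 2 * p + (#s : ℝ) ^ 4 * (2 * √p + 1) := by
  have hexp (x : ZMod p) : ((‖∑ b ∈ s, χ (x + b)‖ ^ 4 : ℝ) : ℂ) =
      ∑ b₁ ∈ s, ∑ b₂ ∈ s, ∑ b₃ ∈ s, ∑ b₄ ∈ s,
        χ ((x + b₁) * (x + b₂) * ((x + b₃)⁻¹ * (x + b₄)⁻¹)) := by
    have hconj : star (∑ b ∈ s, χ (x + b)) = ∑ b ∈ s, χ (x + b)⁻¹ := by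
      rw [star_sum]
      exact sum_congr rfl fun b _ => by
        rw [← MulChar.star_apply, MulChar.star_eq_inv, MulChar.inv_apply']
    have h2 : ((‖∑ b ∈ s, χ (x + b)‖ ^ 2 : ℝ) : ℂ) =
        (∑ b ∈ s, χ (x + b)) * ∑ b ∈ s, χ (x + b)⁻¹ := by
      rw [← hconj]
      push_cast
      exact (Complex.mul_conj' _).symm
    rw [show 4 = 2 * 2 from rfl, pow_mul, Complex.ofReal_pow, h2]
    simp only [map_mul, ← mul_sum, ← sum_mul]
    ring
  have hmain : ((∑ x, ‖∑ b ∈ s, χ (x + b)‖ ^ 4 : ℝ) : ℂ) =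
      ∑ b₁ ∈ s, ∑ b₂ ∈ s, ∑ b₃ ∈ s, ∑ b₄ ∈ s, fourCorrelation χ b₁ b₂ b₃ b₄ := by
    rw [Complex.ofReal_sum, sum_congr rfl fun x _ => hexp x, sum_comm]
    refine sum_congr rfl fun _ _ => ?_
    rw [sum_comm]
    refine sum_congr rfl fun _ _ => ?_
    rw [sum_comm]
    refine sum_congr rfl fun _ _ => ?_
    rw [sum_comm]
    rfl
  have hnonneg : 0 ≤ ∑ x, ‖∑ b ∈ s, χ (x + b)‖ ^ 4 := by positivity
  rw [← Real.norm_of_nonneg hnonneg, ← Complex.norm_real, hmain]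
  calc _ ≤ ∑ b₁ ∈ s, ∑ b₂ ∈ s, ∑ b₃ ∈ s, ∑ b₄ ∈ s, ((2 * √p + 1) +
      ((if b₁ = b₃ ∧ b₂ = b₄ then (p : ℝ) else 0) + (if b₁ = b₄ ∧ b₂ = b₃ then (p : ℝ) else 0) +
        (if b₁ = b₂ ∧ b₃ = b₄ then (p : ℝ) else 0))) :=
      norm_sum_le_of_le _ fun b₁ _ => norm_sum_le_of_le _ fun b₂ _ =>
        norm_sum_le_of_le _ fun b₃ _ => norm_sum_le_of_le _ fun b₄ _ =>
          norm_fourCorrelation_le hχ hp b₁ b₂ b₃ b₄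
    _ = _ := by
      simp only [sum_add_distrib, ite_and, sum_const, nsmul_eq_mul, sum_ite_irrel, sum_ite_eq,
        mul_zero]
      simp +contextual
      ring
end

theorem Int.card_Ioc_filter_modEq_le {r H : ℤ} (hr : 0 < r) (hH : 0 ≤ H) (N v : ℤ) :
    (#{x ∈ Ioc N (N + H) | x ≡ v [ZMOD r]} : ℝ) ≤ H / r + 1 := by
  have h := Int.Ioc_filter_modEq_card N (N + H) hr v
  have hr' : (0 : ℚ) < r := by exact_mod_cast hr
  have hH' : (0 : ℚ) ≤ H := by exact_mod_cast hH
  have h1 : ((#{x ∈ Ioc N (N + H) | x ≡ v [ZMOD r]} : ℤ) : ℚ) ≤ H / r + 1 := by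
    rw [h, Int.cast_max, max_le_iff]
    constructor
    · have h2 := Int.floor_le (((N + H : ℤ) - v) / (r : ℚ))
      have h3 := Int.lt_floor_add_one ((N - v) / (r : ℚ))
      have : ((N + H : ℤ) - v) / (r : ℚ) = (N - v) / (r : ℚ) + H / r := by push_cast; ring
      push_cast at *
      linarith
    · push_cast; positivity
  exact_mod_cast h1

theorem card_linear_eq_le {a b : ℕ} (ha : 0 < a) (hb : 0 < b) (hab : a.Coprime b) {H : ℤ}
    (hH : 0 ≤ H) (N c : ℤ) :
    (#{z ∈ Ioc N (N + H) ×ˢ Ioc N (N + H) | a * z.2 - b * z.1 = c} : ℝ) ≤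
      H / (max a b : ℕ) + 1 := by
  have ha' : (0 : ℤ) < a := by exact_mod_cast ha
  have hb' : (0 : ℤ) < b := by exact_mod_cast hb
  have hab' : IsCoprime (a : ℤ) b := hab.isCoprime
  set S := {z ∈ Ioc N (N + H) ×ˢ Ioc N (N + H) | a * z.2 - b * z.1 = c} with hS
  rcases S.eq_empty_or_nonempty with h0 | ⟨z₀, hz₀⟩
  · rw [h0, card_empty, Nat.cast_zero]
    have : (0 : ℝ) ≤ H := by exact_mod_cast hH
    positivity
  simp only [hS, mem_filter, mem_product] at hz₀
  rcases le_total a b with h | h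
  · rw [max_eq_right h]
    refine le_trans ?_ (Int.card_Ioc_filter_modEq_le hb' hH N z₀.2)
    rw [Nat.cast_le]
    refine card_le_card_of_injOn Prod.snd (fun z hz => ?_) fun z hz w hw hzw => ?_
    · simp only [hS, coe_filter, mem_product, Set.mem_ofPred_eq] at hz ⊢
      refine ⟨hz.1.2, (Int.modEq_iff_dvd.2 (hab'.symm.dvd_of_dvd_mul_left ?_)).symm⟩
      exact ⟨z.1 - z₀.1, by linear_combination hz.2 - hz₀.2⟩
    · simp only [hS, coe_filter, mem_product, Set.mem_ofPred_eq] at hz hw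
      refine Prod.ext (mul_left_cancel₀ hb'.ne' ?_) hzw
      linear_combination hw.2 - hz.2 + a * hzw
  · rw [max_eq_left h]
    refine le_trans ?_ (Int.card_Ioc_filter_modEq_le ha' hH N z₀.1)
    rw [Nat.cast_le]
    refine card_le_card_of_injOn Prod.fst (fun z hz => ?_) fun z hz w hw hzw => ?_
    · simp only [hS, coe_filter, mem_product, Set.mem_ofPred_eq] at hz ⊢
      refine ⟨hz.1.1, (Int.modEq_iff_dvd.2 (hab'.dvd_of_dvd_mul_left ?_)).symm⟩
      exact ⟨z.2 - z₀.2, by linear_combination hz₀.2 - hz.2⟩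
    · simp only [hS, coe_filter, mem_product, Set.mem_ofPred_eq] at hz hw
      refine Prod.ext hzw (mul_left_cancel₀ ha'.ne' ?_)
      linear_combination hz.2 - hw.2 + b * hzw

theorem card_dvd_linear_coprime_le {p a b : ℕ} (hp : 0 < p) (ha : 0 < a) (hb : 0 < b)
    (hab : a.Coprime b) {H : ℤ} (hH : 0 ≤ H) (N : ℤ) :
    (#{z ∈ Ioc N (N + H) ×ˢ Ioc N (N + H) | (p : ℤ) ∣ a * z.2 - b * z.1} : ℝ) ≤
      (H / (max a b : ℕ) + 1) * (2 * (max a b : ℕ) * H / p + 1) := by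
  have hp' : (0 : ℤ) < p := by exact_mod_cast hp
  have hH' : (0 : ℝ) ≤ H := by exact_mod_cast hH
  have ha' : (1 : ℤ) ≤ a := by exact_mod_cast ha
  have hb' : (1 : ℤ) ≤ b := by exact_mod_cast hb
  set T := {c ∈ Ioc (a * N - b * (N + H)) (a * N - b * (N + H) + (a + b) * H) | c ≡ 0 [ZMOD p]}
    with hT
  have hmaps : ∀ z ∈ {z ∈ Ioc N (N + H) ×ˢ Ioc N (N + H) | (p : ℤ) ∣ a * z.2 - b * z.1},
      a * z.2 - b * z.1 ∈ T := by
    intro z hz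
    simp only [hT, mem_filter, mem_product, mem_Ioc] at hz ⊢
    obtain ⟨⟨⟨h1, h2⟩, h3, h4⟩, h5⟩ := hz
    refine ⟨⟨?_, ?_⟩, Int.modEq_zero_iff_dvd.2 h5⟩ <;> nlinarith
  have hTcard : (#T : ℝ) ≤ 2 * (max a b : ℕ) * H / p + 1 := by
    refine (Int.card_Ioc_filter_modEq_le hp' (by positivity) _ _).trans ?_
    have h1 : (a : ℝ) ≤ (max a b : ℕ) := by exact_mod_cast le_max_left a b
    have h2 : (b : ℝ) ≤ (max a b : ℕ) := by exact_mod_cast le_max_right a b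
    push_cast at *
    gcongr
    linarith
  rw [card_eq_sum_card_fiberwise hmaps]
  rw [Nat.cast_sum]
  calc _ ≤ ∑ c ∈ T, ((H : ℝ) / (max a b : ℕ) + 1) := by
        refine sum_le_sum fun c _ => le_trans ?_ (card_linear_eq_le ha hb hab hH N c)
        rw [filter_filter, Nat.cast_le]
        exact card_le_card (monotone_filter_right _ fun z _ hz => (And.right hz :))
    _ = (H / (max a b : ℕ) + 1) * #T := by rw [sum_const, nsmul_eq_mul, mul_comm]
    _ ≤ _ := by gcongr

theorem card_dvd_linear_le {p a b : ℕ} (hp : p.Prime) (ha : 0 < a) (hb : 0 < b) (hap : a < p)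
    {H : ℤ} (hH : 0 ≤ H) (N : ℤ) :
    (#{z ∈ Ioc N (N + H) ×ˢ Ioc N (N + H) | (p : ℤ) ∣ a * z.2 - b * z.1} : ℝ) ≤
      2 * (H : ℝ) ^ 2 / p + H * ((a.gcd b : ℝ) / (max a b : ℕ)) +
        2 * (max a b : ℕ) * H / p + 1 := by
  obtain ⟨g, a', b', hg, hcop, rfl, rfl⟩ := Nat.exists_coprime' (Nat.gcd_pos_of_pos_left b ha)
  have ha' : 0 < a' := Nat.pos_of_mul_pos_right ha
  have hb' : 0 < b' := Nat.pos_of_mul_pos_right hb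
  have hH' : (0 : ℝ) ≤ H := by exact_mod_cast hH
  have hp' : (0 : ℝ) < p := by exact_mod_cast hp.pos
  have hg' : (1 : ℝ) ≤ g := by exact_mod_cast hg
  have hM : (0 : ℝ) < (max a' b' : ℕ) := by exact_mod_cast lt_max_of_lt_left ha'
  have hgp : ¬ (p : ℤ) ∣ g := by
    rw [Int.natCast_dvd_natCast]
    exact fun h => absurd (Nat.le_of_dvd hg h) (by nlinarith)
  rw [Nat.gcd_mul_right, hcop.gcd_eq_one, one_mul, Nat.mul_max_mul_right, Nat.cast_mul (max a' b')]
  refine le_trans (le_trans ?_ (card_dvd_linear_coprime_le hp.pos ha' hb' hcop hH N)) ?_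
  · rw [Nat.cast_le]
    refine card_le_card (monotone_filter_right _ fun z _ hz => ?_)
    have hz : (p : ℤ) ∣ (a' * g : ℕ) * z.2 - (b' * g : ℕ) * z.1 := hz
    refine ((Nat.prime_iff_prime_int.1 hp).dvd_mul.1 ?_).resolve_left hgp
    rwa [Nat.cast_mul, Nat.cast_mul, mul_comm (a' : ℤ), mul_comm (b' : ℤ), mul_assoc, mul_assoc,
      ← mul_sub] at hz
  · have h1 : (2 : ℝ) * (max a' b' : ℕ) * H / p ≤ 2 * ((max a' b' : ℕ) * g) * H / p := by
      gcongr
      exact le_mul_of_one_le_right hM.le hg'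
    have h2 : (g : ℝ) / ((max a' b' : ℕ) * g) = 1 / (max a' b' : ℕ) := by
      field_simp
    have h3 : ((H : ℝ) / (max a' b' : ℕ) + 1) * (2 * (max a' b' : ℕ) * H / p + 1) =
        2 * H ^ 2 / p + H * (1 / (max a' b' : ℕ)) + 2 * (max a' b' : ℕ) * H / p + 1 := by
      field_simp; ring
    rw [h2, h3]
    linarith

theorem sum_gcd_le (A : ℕ) {a : ℕ} (ha : a ≤ A) :
    ∑ b ∈ Ioc 0 a, b.gcd a ≤ a * #{d ∈ Ioc 0 A | d ∣ a} := by
  calc ∑ b ∈ Ioc 0 a, b.gcd a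
      ≤ ∑ b ∈ Ioc 0 a, ∑ d ∈ Ioc 0 A with d ∣ a, if d ∣ b then d else 0 := by
        refine sum_le_sum fun b hb => ?_
        rw [mem_Ioc] at hb
        have h1 : b.gcd a ∈ ({d ∈ Ioc 0 A | d ∣ a} : Finset ℕ) := by
          rw [mem_filter, mem_Ioc]
          exact ⟨⟨Nat.gcd_pos_of_pos_left _ hb.1, (Nat.gcd_le_left _ hb.1).trans (hb.2.trans ha)⟩,
            Nat.gcd_dvd_right _ _⟩
        refine le_trans ?_ (single_le_sum (fun _ _ => Nat.zero_le _) h1)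
        rw [if_pos (Nat.gcd_dvd_left _ _)]
    _ = ∑ d ∈ Ioc 0 A with d ∣ a, #{b ∈ Ioc 0 a | d ∣ b} * d := by
        rw [sum_comm]
        simp only [← sum_filter, sum_const, smul_eq_mul]
    _ ≤ ∑ d ∈ Ioc 0 A with d ∣ a, a := by
        refine sum_le_sum fun d _ => ?_
        rw [Nat.Ioc_filter_dvd_card_eq_div]
        exact Nat.div_mul_le_self a d
    _ = _ := by rw [sum_const, smul_eq_mul, mul_comm]

theorem sum_gcd_div_max_le (A : ℕ) :
    ∑ a ∈ Ioc 0 A, ∑ b ∈ Ioc 0 A, (a.gcd b : ℝ) / (max a b : ℕ) ≤ 2 * A * (1 + Real.log A) := by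
  have hhalf : ∑ a ∈ Ioc 0 A, ∑ b ∈ Ioc 0 a, (b.gcd a : ℝ) / a ≤ A * (1 + Real.log A) := by
    calc _ ≤ ∑ a ∈ Ioc 0 A, (#{d ∈ Ioc 0 A | d ∣ a} : ℝ) := by
          refine sum_le_sum fun a ha => ?_
          rw [mem_Ioc] at ha
          have ha0 : (0 : ℝ) < a := by exact_mod_cast ha.1
          rw [← sum_div, div_le_iff₀ ha0, mul_comm]
          exact_mod_cast sum_gcd_le A ha.2
      _ = ∑ d ∈ Ioc 0 A, (#{a ∈ Ioc 0 A | d ∣ a} : ℝ) := by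
          exact_mod_cast sum_card_bipartiteAbove_eq_sum_card_bipartiteBelow (fun a d : ℕ => d ∣ a)
      _ ≤ ∑ d ∈ Ioc 0 A, A * (d : ℝ)⁻¹ := by
          refine sum_le_sum fun d _ => ?_
          rw [Nat.Ioc_filter_dvd_card_eq_div, ← div_eq_mul_inv]
          exact Nat.cast_div_le
      _ = A * (harmonic A : ℝ) := by
          rw [← mul_sum, harmonic_eq_sum_Icc]
          push_cast
          rfl
      _ ≤ _ := by gcongr; exact harmonic_le_one_add_log A
  have hterm : ∀ a ∈ Ioc 0 A, ∀ b ∈ Ioc 0 A, (a.gcd b : ℝ) / (max a b : ℕ) ≤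
      (if b ≤ a then (b.gcd a : ℝ) / a else 0) + if a ≤ b then (a.gcd b : ℝ) / b else 0 := by
    intro a _ b _
    rcases le_total a b with h | h
    · rw [max_eq_right h, if_pos h]
      exact le_add_of_nonneg_left (by split_ifs <;> positivity)
    · rw [max_eq_left h, if_pos h, Nat.gcd_comm a b]
      exact le_add_of_nonneg_right (by split_ifs <;> positivity)
  have hfil (a : ℕ) (ha : a ∈ Ioc 0 A) : ({b ∈ Ioc 0 A | b ≤ a} : Finset ℕ) = Ioc 0 a := by
    ext b; simp only [mem_filter, mem_Ioc] at *; omega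
  calc _ ≤ ∑ a ∈ Ioc 0 A, ∑ b ∈ Ioc 0 A,
        ((if b ≤ a then (b.gcd a : ℝ) / a else 0) + if a ≤ b then (a.gcd b : ℝ) / b else 0) :=
        sum_le_sum fun a ha => sum_le_sum fun b hb => hterm a ha b hb
    _ = 2 * ∑ a ∈ Ioc 0 A, ∑ b ∈ Ioc 0 a, (b.gcd a : ℝ) / a := by
        simp only [sum_add_distrib]
        rw [sum_comm (f := fun a b : ℕ => if a ≤ b then (a.gcd b : ℝ) / b else 0), ← two_mul]
        congr 1
        refine sum_congr rfl fun a ha => ?_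
        rw [← sum_filter, hfil a ha]
    _ ≤ _ := by linarith

/-- The number of `x ∈ (N, N + H]` and `a ∈ (0, A]` with `x ≡ a u (mod p)`. -/
noncomputable def ratioCount (p A : ℕ) (N H : ℤ) (u : ZMod p) : ℕ :=
  #{z ∈ Ioc 0 A ×ˢ Ioc N (N + H) | ((z.1 : ZMod p))⁻¹ * z.2 = u}

theorem sum_ratioCount_sq_le {p A : ℕ} [Fact p.Prime] (hA : A < p) {H : ℤ} (hH : 0 ≤ H) (N : ℤ) :
    ∑ u : ZMod p, (ratioCount p A N H u : ℝ) ^ 2 ≤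
      A ^ 2 * (2 * H ^ 2 / p) + 2 * A * H * (1 + Real.log A) + 2 * A ^ 3 * H / p + A ^ 2 := by
  have hp : p.Prime := Fact.out
  have hH' : (0 : ℝ) ≤ H := by exact_mod_cast hH
  set I := Ioc N (N + H) with hI
  have hsq (u : ZMod p) : ratioCount p A N H u ^ 2 =
      #{w ∈ (Ioc 0 A ×ˢ Ioc 0 A) ×ˢ (I ×ˢ I) |
        ((w.1.1 : ZMod p))⁻¹ * w.2.1 = u ∧ ((w.1.2 : ZMod p))⁻¹ * w.2.2 = u} := by
    rw [ratioCount, sq, ← card_product]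
    refine card_bij (fun w _ => ((w.1.1, w.2.1), (w.1.2, w.2.2))) ?_ ?_ ?_
    · intro w hw
      simp only [mem_product, mem_filter] at hw ⊢
      tauto
    · intro w _ w' _ h
      simp only [Prod.mk.injEq] at h
      ext <;> simp [h]
    · intro w hw
      simp only [mem_product, mem_filter] at hw
      exact ⟨((w.1.1, w.2.1), (w.1.2, w.2.2)), by simp only [mem_product, mem_filter]; tauto, rfl⟩
  have hsum : ∑ u : ZMod p, ratioCount p A N H u ^ 2 ≤
      ∑ a ∈ Ioc 0 A ×ˢ Ioc 0 A, #{z ∈ I ×ˢ I | (p : ℤ) ∣ a.1 * z.2 - a.2 * z.1} := by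
    calc _ = ∑ u : ZMod p, #{w ∈ {w ∈ (Ioc 0 A ×ˢ Ioc 0 A) ×ˢ (I ×ˢ I) |
          ((w.1.1 : ZMod p))⁻¹ * w.2.1 = ((w.1.2 : ZMod p))⁻¹ * w.2.2} |
            ((w.1.1 : ZMod p))⁻¹ * w.2.1 = u} := by
          refine sum_congr rfl fun u _ => ?_
          rw [hsq, filter_filter]
          congr 1
          refine filter_congr fun w _ => ?_
          constructor
          · rintro ⟨h1, h2⟩; exact ⟨h1.trans h2.symm, h1⟩
          · rintro ⟨h1, h2⟩; exact ⟨h2, h1 ▸ h2⟩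
      _ = #{w ∈ (Ioc 0 A ×ˢ Ioc 0 A) ×ˢ (I ×ˢ I) |
          ((w.1.1 : ZMod p))⁻¹ * w.2.1 = ((w.1.2 : ZMod p))⁻¹ * w.2.2} :=
          (card_eq_sum_card_fiberwise fun _ _ => mem_univ _).symm
      _ = ∑ a ∈ Ioc 0 A ×ˢ Ioc 0 A, #{z ∈ I ×ˢ I |
          ((a.1 : ZMod p))⁻¹ * z.1 = ((a.2 : ZMod p))⁻¹ * z.2} := by
          simp only [card_filter, sum_product]
      _ ≤ _ := by
          refine sum_le_sum fun a ha => card_le_card (monotone_filter_right _ fun z _ hz => ?_)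
          simp only [mem_product, mem_Ioc] at ha
          have hne (c : ℕ) (h0 : 0 < c) (h : c ≤ A) : (c : ZMod p) ≠ 0 := by
            rw [Ne, ZMod.natCast_eq_zero_iff]
            exact fun hd => absurd (Nat.le_of_dvd h0 hd) (by omega)
          have h1 := hne _ ha.1.1 ha.1.2
          have h2 := hne _ ha.2.1 ha.2.2
          change (p : ℤ) ∣ a.1 * z.2 - a.2 * z.1
          rw [← ZMod.intCast_zmod_eq_zero_iff_dvd]
          push_cast
          field_simp at hz
          linear_combination -hz
  calc _ ≤ ∑ a ∈ Ioc 0 A ×ˢ Ioc 0 A,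
        (#{z ∈ I ×ˢ I | (p : ℤ) ∣ a.1 * z.2 - a.2 * z.1} : ℝ) := by exact_mod_cast hsum
    _ ≤ ∑ a ∈ Ioc 0 A ×ˢ Ioc 0 A, (2 * (H : ℝ) ^ 2 / p +
        H * ((a.1.gcd a.2 : ℝ) / (max a.1 a.2 : ℕ)) + 2 * A * H / p + 1) := by
        refine sum_le_sum fun a ha => ?_
        simp only [mem_product, mem_Ioc] at ha
        refine (card_dvd_linear_le hp ha.1.1 ha.2.1 (by omega) hH N).trans ?_
        have : (max a.1 a.2 : ℕ) ≤ A := max_le ha.1.2 ha.2.2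
        gcongr
    _ ≤ _ := by
        simp only [sum_add_distrib, ← mul_sum, sum_const, card_product, Nat.card_Ioc,
          nsmul_eq_mul, sum_product]
        have := mul_le_mul_of_nonneg_left (sum_gcd_div_max_le A) hH'
        push_cast at *
        have e : ((A : ℝ) - 0) = A := sub_zero _
        simp only [Nat.sub_zero]
        ring_nf at *
        linarith

theorem sum_mul_pow_four_le {ι : Type*} (s : Finset ι) {v F : ι → ℝ} (hv : ∀ i ∈ s, 0 ≤ v i) :
    (∑ i ∈ s, v i * F i) ^ 4 ≤ (∑ i ∈ s, v i) ^ 2 * (∑ i ∈ s, v i ^ 2) * ∑ i ∈ s, F i ^ 4 := by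
  have h1 : (∑ i ∈ s, v i * F i) ^ 2 ≤ (∑ i ∈ s, v i) * ∑ i ∈ s, v i * F i ^ 2 := by
    have e1 : ∑ i ∈ s, v i * F i = ∑ i ∈ s, √(v i) * (√(v i) * F i) :=
      sum_congr rfl fun i hi => by rw [← mul_assoc, Real.mul_self_sqrt (hv i hi)]
    have e2 : ∑ i ∈ s, v i = ∑ i ∈ s, √(v i) ^ 2 :=
      sum_congr rfl fun i hi => (Real.sq_sqrt (hv i hi)).symm
    have e3 : ∑ i ∈ s, v i * F i ^ 2 = ∑ i ∈ s, (√(v i) * F i) ^ 2 :=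
      sum_congr rfl fun i hi => by rw [mul_pow, Real.sq_sqrt (hv i hi)]
    rw [e1, e2, e3]
    exact sum_mul_sq_le_sq_mul_sq s _ _
  have h2 : (∑ i ∈ s, v i * F i ^ 2) ^ 2 ≤ (∑ i ∈ s, v i ^ 2) * ∑ i ∈ s, F i ^ 4 := by
    have e : ∑ i ∈ s, F i ^ 4 = ∑ i ∈ s, (F i ^ 2) ^ 2 := sum_congr rfl fun i _ => by ring
    rw [e]
    exact sum_mul_sq_le_sq_mul_sq s v (fun i => F i ^ 2)
  calc (∑ i ∈ s, v i * F i) ^ 4 = ((∑ i ∈ s, v i * F i) ^ 2) ^ 2 := by ring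
    _ ≤ ((∑ i ∈ s, v i) * ∑ i ∈ s, v i * F i ^ 2) ^ 2 := by gcongr
    _ = (∑ i ∈ s, v i) ^ 2 * (∑ i ∈ s, v i * F i ^ 2) ^ 2 := by ring
    _ ≤ (∑ i ∈ s, v i) ^ 2 * ((∑ i ∈ s, v i ^ 2) * ∑ i ∈ s, F i ^ 4) := by gcongr
    _ = _ := by ring

theorem Int.sum_Ioc_add_sum_Ioc {R : Type*} [AddCommMonoid R] (f : ℤ → R) {a b c : ℤ}
    (hab : a ≤ b) (hbc : b ≤ c) :
    ∑ x ∈ Ioc a b, f x + ∑ x ∈ Ioc b c, f x = ∑ x ∈ Ioc a c, f x := by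
  rw [← Ioc_union_Ioc_eq_Ioc hab hbc, sum_union (Ioc_disjoint_Ioc_of_le le_rfl)]

section
variable {p : ℕ} [Fact p.Prime]

/-- The sum of `χ` over the interval `(N, N + H]`. -/
noncomputable def intervalCharSum (χ : MulChar (ZMod p) ℂ) (N H : ℤ) : ℂ :=
  ∑ x ∈ Ioc N (N + H), χ (x : ZMod p)

theorem norm_intervalCharSum_sub_shift_le (χ : MulChar (ZMod p) ℂ) (N : ℤ) {H h : ℤ}
    (hH : 0 ≤ H) (hh : 0 ≤ h) {E : ℝ} (hE : ∀ N, ‖intervalCharSum χ N h‖ ≤ E) :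
    ‖intervalCharSum χ N H - ∑ x ∈ Ioc N (N + H), χ ((x : ZMod p) + (h : ZMod p))‖ ≤
      2 * E := by
  have hshift : ∑ x ∈ Ioc N (N + H), χ ((x : ZMod p) + (h : ZMod p)) =
      ∑ x ∈ Ioc (N + h) (N + H + h), χ (x : ZMod p) := by
    rw [← map_add_right_Ioc, sum_map]
    simp
  have h1 := Int.sum_Ioc_add_sum_Ioc (fun x => χ (x : ZMod p)) (show N ≤ N + h by omega)
    (show N + h ≤ N + H + h by omega)
  have h2 := Int.sum_Ioc_add_sum_Ioc (fun x => χ (x : ZMod p)) (show N ≤ N + H by omega)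
    (show N + H ≤ N + H + h by omega)
  have e : intervalCharSum χ N H - ∑ x ∈ Ioc N (N + H), χ ((x : ZMod p) + (h : ZMod p)) =
      intervalCharSum χ N h - intervalCharSum χ (N + H) h := by
    rw [hshift]
    simp only [intervalCharSum]
    linear_combination h2 - h1
  rw [e, two_mul]
  exact (norm_sub_le _ _).trans (add_le_add (hE N) (hE _))

theorem mul_norm_intervalCharSum_le {χ : MulChar (ZMod p) ℂ} (hχ : χ ≠ 1) (hp : 3 ≤ p)
    {A B : ℕ} (hA : A < p) (hB : B < p) (N : ℤ) {H : ℤ} (hH : 0 ≤ H) {E : ℕ → ℝ}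
    (hE : ∀ a ∈ Ioc 0 A, ∀ b ∈ Ioc 0 B, ∀ N, ‖intervalCharSum χ N (a * b : ℕ)‖ ≤ E (a * b)) :
    ∃ M : ℝ, 0 ≤ M ∧ M ^ 4 ≤ (A * H) ^ 2 * (∑ u, (ratioCount p A N H u : ℝ) ^ 2) *
        (3 * (B : ℝ) ^ 2 * p + (B : ℝ) ^ 4 * (2 * √p + 1)) ∧
      A * B * ‖intervalCharSum χ N H‖ ≤ M + 2 * ∑ a ∈ Ioc 0 A, ∑ b ∈ Ioc 0 B, E (a * b) := by
  set F : ZMod p → ℝ := fun u => ‖∑ b ∈ Ioc 0 B, χ (u + (b : ZMod p))‖ with hF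
  refine ⟨∑ u, (ratioCount p A N H u : ℝ) * F u, ?_, ?_, ?_⟩
  · exact sum_nonneg fun u _ => mul_nonneg (Nat.cast_nonneg _) (norm_nonneg _)
  · refine (sum_mul_pow_four_le univ fun _ _ => Nat.cast_nonneg _).trans ?_
    have h1 : ∑ u : ZMod p, (ratioCount p A N H u : ℝ) = A * H := by
      have : ∑ u : ZMod p, ratioCount p A N H u = A * H.toNat := by
        simp only [ratioCount]
        rw [← card_eq_sum_card_fiberwise fun _ _ => mem_univ _, card_product, Nat.card_Ioc,
          Int.card_Ioc]
        simp
      have h2 : ((H.toNat : ℤ) : ℝ) = H := by rw [Int.toNat_of_nonneg hH]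
      rw [← h2]
      exact_mod_cast this
    have hinj : Set.InjOn (fun b : ℕ => (b : ZMod p)) (Ioc 0 B) := by
      intro b hb c hc hbc
      rw [coe_Ioc, Set.mem_Ioc] at hb hc
      have := (ZMod.natCast_eq_natCast_iff' _ _ _).1 hbc
      rwa [Nat.mod_eq_of_lt (by omega), Nat.mod_eq_of_lt (by omega)] at this
    have h2 : ∑ u, F u ^ 4 ≤ 3 * (B : ℝ) ^ 2 * p + (B : ℝ) ^ 4 * (2 * √p + 1) := by
      have := sum_norm_sum_mulChar_pow_four_le hχ hp ((Ioc 0 B).image fun b : ℕ => (b : ZMod p))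
      rw [card_image_of_injOn hinj, Nat.card_Ioc, Nat.sub_zero] at this
      convert this using 4
      rw [sum_image hinj]
    rw [h1]
    gcongr
  · have hmain : ‖∑ a ∈ Ioc 0 A, ∑ b ∈ Ioc 0 B, ∑ x ∈ Ioc N (N + H),
        χ ((x : ZMod p) + ((a * b : ℕ) : ZMod p))‖ ≤ ∑ u, (ratioCount p A N H u : ℝ) * F u := by
      calc _ = ‖∑ z ∈ Ioc 0 A ×ˢ Ioc N (N + H), ∑ b ∈ Ioc 0 B,
            χ ((z.2 : ZMod p) + ((z.1 * b : ℕ) : ZMod p))‖ := by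
            rw [sum_product]
            congr 1
            exact sum_congr rfl fun a _ => sum_comm
        _ ≤ ∑ z ∈ Ioc 0 A ×ˢ Ioc N (N + H), F ((z.1 : ZMod p)⁻¹ * z.2) := by
            refine norm_sum_le_of_le _ fun z hz => ?_
            rw [mem_product, mem_Ioc] at hz
            have hne : (z.1 : ZMod p) ≠ 0 := by
              rw [Ne, ZMod.natCast_eq_zero_iff]
              exact fun hd => absurd (Nat.le_of_dvd hz.1.1 hd) (by omega)
            have : ∀ b : ℕ, χ ((z.2 : ZMod p) + ((z.1 * b : ℕ) : ZMod p)) =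
                χ (z.1 : ZMod p) * χ ((z.1 : ZMod p)⁻¹ * z.2 + b) := by
              intro b
              rw [← map_mul]
              congr 1
              push_cast
              field_simp
            simp only [this]
            rw [← mul_sum, norm_mul]
            exact mul_le_of_le_one_left (norm_nonneg _) (DirichletCharacter.norm_le_one χ _)
        _ = _ := by
            rw [← sum_fiberwise_of_maps_to (t := univ)
              (g := fun z : ℕ × ℤ => (z.1 : ZMod p)⁻¹ * (z.2 : ZMod p)) (fun _ _ => mem_univ _)]
            refine sum_congr rfl fun u _ => ?_
            rw [ratioCount, ← nsmul_eq_mul, ← sum_const]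
            refine sum_congr rfl fun z hz => ?_
            rw [(mem_filter.1 hz).2]
    have key : ∀ a ∈ Ioc 0 A, ∀ b ∈ Ioc 0 B, ‖intervalCharSum χ N H - ∑ x ∈ Ioc N (N + H),
        χ ((x : ZMod p) + ((a * b : ℕ) : ZMod p))‖ ≤ 2 * E (a * b) := by
      intro a ha b hb
      have := norm_intervalCharSum_sub_shift_le χ N hH (Int.natCast_nonneg (a * b))
        (hE a ha b hb)
      rwa [Int.cast_natCast] at this
    have e : (A * B : ℂ) * intervalCharSum χ N H =
        ∑ a ∈ Ioc 0 A, ∑ b ∈ Ioc 0 B, ∑ x ∈ Ioc N (N + H),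
          χ ((x : ZMod p) + ((a * b : ℕ) : ZMod p)) +
        ∑ a ∈ Ioc 0 A, ∑ b ∈ Ioc 0 B, (intervalCharSum χ N H - ∑ x ∈ Ioc N (N + H),
          χ ((x : ZMod p) + ((a * b : ℕ) : ZMod p))) := by
      simp only [← sum_add_distrib, add_sub_cancel, sum_const, Nat.card_Ioc, Nat.sub_zero,
        nsmul_eq_mul, mul_assoc]
    calc (A * B * ‖intervalCharSum χ N H‖ : ℝ) = ‖(A * B : ℂ) * intervalCharSum χ N H‖ := by
          rw [norm_mul, norm_mul, Complex.norm_natCast, Complex.norm_natCast]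
      _ ≤ _ := by
          rw [e, mul_sum]
          simp only [mul_sum]
          exact (norm_add_le _ _).trans (add_le_add hmain
            (norm_sum_le_of_le _ fun a ha => norm_sum_le_of_le _ fun b hb => key a ha b hb))
end

theorem sum_sqrt_le (n : ℕ) : ∑ a ∈ Ioc 0 n, √(a : ℝ) ≤ √n * (2 * n / 3 + 1) := by
  induction n with
  | zero => simp
  | succ n ih =>
    rw [sum_Ioc_succ_top (Nat.zero_le n)]
    have hs : √(n : ℝ) ^ 2 = n := Real.sq_sqrt (Nat.cast_nonneg n)
    have ht : √((n + 1 : ℕ) : ℝ) ^ 2 = n + 1 := by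
      rw [Real.sq_sqrt (Nat.cast_nonneg _)]; push_cast; ring
    have hst : √(n : ℝ) ≤ √((n + 1 : ℕ) : ℝ) := Real.sqrt_le_sqrt (by push_cast; linarith)
    have hs0 : 0 ≤ √(n : ℝ) := Real.sqrt_nonneg _
    set s := √(n : ℝ)
    set t := √((n + 1 : ℕ) : ℝ)
    have hn : (n : ℝ) = s ^ 2 := hs.symm
    refine (add_le_add_left ih _).trans ?_
    push_cast
    rw [hn]
    have h1 : s ^ 2 + 1 = t ^ 2 := by rw [ht, hs]
    have h2 : 0 < t := by nlinarith
    rw [h1]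
    have h3 : 0 ≤ (t + s) * (t ^ 3 - s ^ 3) * 2 - 3 * s * (t + s) := by
      have : (t + s) * (t ^ 3 - s ^ 3) = t ^ 2 + t * s + s ^ 2 := by
        linear_combination (-(t ^ 2 + t * s + s ^ 2)) * h1
      nlinarith [mul_nonneg (sub_nonneg.2 hst) (by positivity : 0 ≤ 2 * t + s)]
    have h4 : 0 ≤ (t ^ 3 - s ^ 3) * 2 - 3 * s := by
      have : 0 < t + s := by positivity
      refine nonneg_of_mul_nonneg_right (a := t + s) ?_ this
      linarith
    nlinarith

/-- The bound for the second moment of `ratioCount` in the range used for Burgess' inequality. -/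
theorem second_moment_numerics {A H L t B : ℝ} (hA : 1 ≤ A) (ht : 10 ^ 5 ≤ t ^ 4) (ht0 : 0 < t)
    (hL : L = 16 * Real.log t) (hL1 : 45.7 ≤ L) (hH : H ≤ 2 * t ^ 10) (hAB : 7 * (A * B) ≤ H)
    (hB : 1.2499 * t ^ 4 ≤ B) :
    A ^ 2 * (2 * H ^ 2 / t ^ 16) + 2 * A * H * (1 + Real.log A) + 2 * A ^ 3 * H / t ^ 16 + A ^ 2 ≤
      0.76 * (A * H * L) := by
  have hA0 : 0 < A := by linarith
  have hB1 : 100 ≤ B := by linarith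
  have hAH : 700 * A ≤ H := by nlinarith
  have hH0 : 0 < H := by linarith
  have hAt : A ≤ 0.2287 * t ^ 6 := by
    have : 7 * 1.2499 * (A * t ^ 4) ≤ 2 * (t ^ 6 * t ^ 4) := by nlinarith
    have h4 : 0 < t ^ 4 := by positivity
    have : 7 * 1.2499 * A ≤ 2 * t ^ 6 := by nlinarith
    linarith
  have hlog : Real.log A ≤ 0.375 * L - 1.386 := by
    have h1 : Real.log A ≤ Real.log (t ^ 6 / 2 ^ 2) :=
      Real.log_le_log hA0 (by linarith [pow_pos ht0 6])
    rw [Real.log_div (by positivity) (by positivity), Real.log_pow, Real.log_pow] at h1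
    have := Real.log_two_gt_d9
    push_cast at h1
    rw [hL]
    linarith
  have e1 : A ^ 2 * (2 * H ^ 2 / t ^ 16) ≤ 0.9148 * (A * H) := by
    have : A * H ≤ 0.4574 * t ^ 16 := by
      calc A * H ≤ (0.2287 * t ^ 6) * (2 * t ^ 10) := by gcongr
        _ = _ := by ring
    have e : A ^ 2 * (2 * H ^ 2 / t ^ 16) = 2 * (A * H) * ((A * H) / t ^ 16) := by ring
    rw [e]
    have : (A * H) / t ^ 16 ≤ 0.4574 := by rwa [div_le_iff₀ (by positivity)]
    nlinarith [mul_pos hA0 hH0]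
  have e2 : 2 * A ^ 3 * H / t ^ 16 ≤ 0.01 * (A * H) := by
    have h1 : A ^ 2 ≤ 0.005 * t ^ 16 := by
      calc A ^ 2 ≤ (0.2287 * t ^ 6) ^ 2 := by gcongr
        _ ≤ 0.0524 * t ^ 12 * 1 := by nlinarith [pow_pos ht0 12]
        _ ≤ 0.0524 * t ^ 12 * (t ^ 4 / 20) := by gcongr; linarith
        _ ≤ _ := by nlinarith [pow_pos ht0 16]
    rw [div_le_iff₀ (by positivity)]
    nlinarith [mul_pos hA0 hH0, mul_le_mul_of_nonneg_left h1 (mul_pos hA0 hH0).le]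
  have e3 : A ^ 2 ≤ 0.01 * (A * H) := by nlinarith
  have e4 : 2 * A * H * (1 + Real.log A) ≤ (A * H) * (0.75 * L - 0.772) := by
    nlinarith [mul_pos hA0 hH0]
  nlinarith [mul_pos hA0 hH0]

theorem fourth_moment_numerics {A B H t : ℝ} (hA : 3000 ≤ A) (ht : 10 ^ 5 ≤ t ^ 4)
    (hAB : H ≤ 7 * B * (A + 1)) (hB : 1.2499 * t ^ 4 ≤ B) (hB2 : B ≤ 1.25 * t ^ 4) :
    0.76 * H * (3 * t ^ 16 + B ^ 2 * (2 * t ^ 8 + 1)) ≤ 31.49 * A * B ^ 2 * t ^ 12 := by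
  obtain ⟨y, hy⟩ : ∃ y, y = t ^ 4 := ⟨_, rfl⟩
  rw [show t ^ 16 = y ^ 4 by rw [hy]; ring, show t ^ 8 = y ^ 2 by rw [hy]; ring,
    show t ^ 12 = y ^ 3 by rw [hy]; ring]
  rw [← hy] at ht hB hB2
  have hy0 : 0 < y := by linarith
  have hB0 : 0 < B := by linarith
  have h1 : H ≤ 7.0024 * (A * B) := by nlinarith
  have h2 : 3 * y ^ 4 + B ^ 2 * (2 * y ^ 2 + 1) ≤ 6.126 * y ^ 4 := by
    have hBB : B ^ 2 ≤ (1.25 * y) ^ 2 := by gcongr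
    have : (1 : ℝ) ≤ 0.0001 * y ^ 2 := by nlinarith
    calc _ ≤ 3 * y ^ 4 + (1.25 * y) ^ 2 * (2 * y ^ 2 + 0.0001 * y ^ 2) := by gcongr
      _ ≤ _ := by nlinarith [pow_pos hy0 4]
  calc _ ≤ 0.76 * (7.0024 * (A * B)) * (6.126 * y ^ 4) := by gcongr
    _ = (0.76 * 7.0024 * 6.126 * y) * (A * B * y ^ 3) := by ring
    _ ≤ (31.49 * B) * (A * B * y ^ 3) := by
      gcongr ?_ * _
      linarith
    _ = _ := by ring
theorem moment_root_numerics {A B H M V Q t l s : ℝ} (hA : 3000 ≤ A) (ht : 10 ^ 5 ≤ t ^ 4)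
    (ht0 : 0 < t) (hl0 : 0 < l) (hs : 0 ≤ s) (hsH : s ^ 2 = H) (hAB : H ≤ 7 * B * (A + 1))
    (hB : 1.2499 * t ^ 4 ≤ B) (hB2 : B ≤ 1.25 * t ^ 4) (hV : V ≤ 0.76 * (A * H * l ^ 4))
    (hQ : Q = 3 * B ^ 2 * t ^ 16 + B ^ 4 * (2 * t ^ 8 + 1)) (hM : M ^ 4 ≤ (A * H) ^ 2 * V * Q) :
    M ≤ A * B * (2.369 * s * (t ^ 3 * l)) := by
  have hB0 : 0 < B := by linarith
  have hA0 : 0 < A := by linarith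
  have hH0 : 0 ≤ H := hsH ▸ sq_nonneg s
  have hQ0 : 0 ≤ Q := by rw [hQ]; positivity
  refine le_of_pow_le_pow_left₀ (n := 4) (by norm_num) (by positivity) (hM.trans ?_)
  have h4 := fourth_moment_numerics hA ht hAB hB hB2
  calc _ ≤ (A * H) ^ 2 * (0.76 * (A * H * l ^ 4)) * Q := by gcongr
    _ = (0.76 * H * (3 * t ^ 16 + B ^ 2 * (2 * t ^ 8 + 1))) *
        (A ^ 3 * H ^ 2 * B ^ 2 * l ^ 4) := by rw [hQ]; ring
    _ ≤ (31.49 * A * B ^ 2 * t ^ 12) * (A ^ 3 * H ^ 2 * B ^ 2 * l ^ 4) :=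
        mul_le_mul_of_nonneg_right h4 (by positivity)
    _ = 31.49 * (A ^ 4 * B ^ 4 * H ^ 2 * t ^ 12 * l ^ 4) := by ring
    _ ≤ 2.369 ^ 4 * (A ^ 4 * B ^ 4 * H ^ 2 * t ^ 12 * l ^ 4) :=
        mul_le_mul_of_nonneg_right (by norm_num) (by positivity)
    _ = _ := by rw [← hsH]; ring

theorem sum_sqrt_mul_le {A B : ℕ} {H K : ℝ} (hK : 0 ≤ K) (hA : (3000 : ℝ) ≤ A)
    (hB : (3000 : ℝ) ≤ B) (hAB : 7 * ((A : ℝ) * B) ≤ H) :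
    2 * ∑ a ∈ Ioc 0 A, ∑ b ∈ Ioc 0 B, 3.57 * √((a * b : ℕ) : ℝ) * K ≤
      A * B * (1.201 * √H * K) := by
  have e : ∑ a ∈ Ioc 0 A, ∑ b ∈ Ioc 0 B, 3.57 * √((a * b : ℕ) : ℝ) * K =
      3.57 * K * ((∑ a ∈ Ioc 0 A, √(a : ℝ)) * ∑ b ∈ Ioc 0 B, √(b : ℝ)) := by
    rw [sum_mul_sum, mul_sum]
    refine sum_congr rfl fun a _ => ?_
    rw [mul_sum]
    refine sum_congr rfl fun b _ => ?_
    rw [Nat.cast_mul, Real.sqrt_mul (Nat.cast_nonneg a)]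
    ring
  have hbd {n : ℕ} (hn : (3000 : ℝ) ≤ n) : ∑ a ∈ Ioc 0 n, √(a : ℝ) ≤ √n * (0.667 * n) :=
    (sum_sqrt_le n).trans (mul_le_mul_of_nonneg_left (by linarith) (Real.sqrt_nonneg _))
  have hsAB : √(A : ℝ) * √(B : ℝ) ≤ 0.378 * √H := by
    have hH : 0 ≤ H := le_trans (by positivity) hAB
    refine le_of_sq_le_sq ?_ (by positivity)
    rw [mul_pow, mul_pow, Real.sq_sqrt (Nat.cast_nonneg _), Real.sq_sqrt (Nat.cast_nonneg _),
      Real.sq_sqrt hH]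
    linarith
  rw [e]
  calc _ ≤ 2 * (3.57 * K * ((√A * (0.667 * A)) * (√B * (0.667 * B)))) := by
        gcongr
        · exact hbd hA
        · exact hbd hB
    _ = 2 * 3.57 * 0.667 ^ 2 * (K * A * B) * (√A * √B) := by ring
    _ ≤ 2 * 3.57 * 0.667 ^ 2 * (K * A * B) * (0.378 * √H) :=
        mul_le_mul_of_nonneg_left hsAB (by positivity)
    _ = (2 * 3.57 * 0.667 ^ 2 * 0.378) * (K * A * B * √H) := by ring
    _ ≤ 1.201 * (K * A * B * √H) := mul_le_mul_of_nonneg_right (by norm_num) (by positivity)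
    _ = _ := by ring

section
variable {p : ℕ} [Fact p.Prime]

/-- Burgess' inequality with `r = 2`, in terms of a sixteenth root of `p` and a fourth root of
`log p`. -/
theorem norm_intervalCharSum_le_aux {χ : MulChar (ZMod p) ℂ} (hχ : χ ≠ 1) {t l : ℝ} (ht0 : 0 < t)
    (hl0 : 0 < l) (htp : t ^ 16 = p) (ht : 10 ^ 5 ≤ t ^ 4) (hl : l ^ 4 = 16 * Real.log t)
    (hl1 : 45.7 ≤ l ^ 4) (H : ℕ) (hH : (H : ℝ) ≤ 2 * t ^ 10) (N : ℤ) :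
    ‖intervalCharSum χ N H‖ ≤ 3.57 * √H * (t ^ 3 * l) := by
  induction H using Nat.strong_induction_on generalizing N with
  | _ H ih =>
  set K := t ^ 3 * l with hK
  have hK0 : 0 < K := by positivity
  have hH0 : (0 : ℝ) ≤ H := Nat.cast_nonneg H
  have hHsq : √(H : ℝ) ^ 2 = H := Real.sq_sqrt hH0
  have hs0 : 0 ≤ √(H : ℝ) := Real.sqrt_nonneg _
  rcases le_or_gt √(H : ℝ) (3.57 * K) with hsmall | hlarge
  · calc ‖intervalCharSum χ N H‖ ≤ ∑ x ∈ Ioc N (N + H), (1 : ℝ) :=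
          norm_sum_le_of_le _ fun x _ => DirichletCharacter.norm_le_one χ _
      _ = √(H : ℝ) * √(H : ℝ) := by rw [← sq, hHsq]; simp
      _ ≤ 3.57 * K * √(H : ℝ) := by gcongr
      _ = _ := by ring
  have hl2 : 6.7 ≤ l ^ 2 := by nlinarith [sq_nonneg l]
  have ht2 : 316 ≤ t ^ 2 := by nlinarith [sq_nonneg t]
  have hHl : 85 * t ^ 6 ≤ H := by
    have h1 : (3.57 * K) ^ 2 ≤ H := by rw [← hHsq]; gcongr
    have h2 : (3.57 * K) ^ 2 = 3.57 ^ 2 * l ^ 2 * t ^ 6 := by rw [hK]; ring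
    nlinarith [pow_pos ht0 6]
  set B := ⌊1.25 * t ^ 4⌋₊ with hBdef
  have hB2 : (B : ℝ) ≤ 1.25 * t ^ 4 := Nat.floor_le (by positivity)
  have hB1 : 1.2499 * t ^ 4 ≤ B := by
    have := Nat.lt_floor_add_one (1.25 * t ^ 4)
    rw [← hBdef] at this
    linarith
  have hB0 : (0 : ℝ) < B := by linarith
  set A := ⌊(H : ℝ) / (7 * B)⌋₊ with hAdef
  have hA2 : (A : ℝ) ≤ H / (7 * B) := Nat.floor_le (by positivity)
  have hA1 : (H : ℝ) / (7 * B) < A + 1 := Nat.lt_floor_add_one _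
  rw [le_div_iff₀ (by positivity)] at hA2
  rw [div_lt_iff₀ (by positivity)] at hA1
  have hA3000 : (3000 : ℝ) ≤ A := by
    have h1 : 85 * t ^ 2 * t ^ 4 < (A + 1) * (7 * 1.25) * t ^ 4 := by
      have : (A + 1 : ℝ) * (7 * B) ≤ (A + 1) * (7 * (1.25 * t ^ 4)) := by gcongr
      nlinarith
    have h2 := lt_of_mul_lt_mul_right h1 (by positivity)
    linarith
  have hAB : 7 * ((A : ℝ) * B) ≤ H := by linarith
  have hp1 : (1 : ℝ) ≤ t ^ 6 := one_le_pow₀ (by nlinarith)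
  have hHp : (H : ℝ) < p := by
    rw [← htp]
    have : t ^ 16 = t ^ 4 * t ^ 2 * t ^ 10 := by ring
    have : 2 * t ^ 10 < t ^ 4 * t ^ 2 * t ^ 10 := by
      gcongr; nlinarith
    linarith
  have hAp : A < p := by
    have : (A : ℝ) < p := by nlinarith
    exact_mod_cast this
  have hBp : B < p := by
    have : (B : ℝ) < p := by nlinarith
    exact_mod_cast this
  have hp3 : 3 ≤ p := by
    have : (3 : ℝ) ≤ p := by nlinarith
    exact_mod_cast this
  obtain ⟨M, hM0, hM, hS⟩ := mul_norm_intervalCharSum_le hχ hp3 hAp hBp N (Int.natCast_nonneg H)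
    (E := fun h => 3.57 * √h * K) (fun a ha b hb N' => by
      rw [mem_Ioc] at ha hb
      have hab : a * b ≤ A * B := Nat.mul_le_mul ha.2 hb.2
      have hab' : ((a * b : ℕ) : ℝ) ≤ A * B := by exact_mod_cast hab
      have hlt : ((a * b : ℕ) : ℝ) < H := by
        have : 0 < (A : ℝ) * B := by positivity
        linarith
      exact ih _ (by exact_mod_cast hlt) (hlt.le.trans hH) N')
  have hsqrtp : √(p : ℝ) = t ^ 8 := by
    rw [← htp, show t ^ 16 = (t ^ 8) ^ 2 by ring, Real.sqrt_sq (by positivity)]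
  have hV := sum_ratioCount_sq_le hAp (Int.natCast_nonneg H) N
  rw [hsqrtp, Int.cast_natCast, ← htp] at hM
  rw [Int.cast_natCast, ← htp] at hV
  clear_value A B K
  have hMle : M ≤ A * B * (2.369 * √H * K) := by
    rw [hK]
    exact moment_root_numerics hA3000 ht ht0 hl0 hs0 hHsq (by linarith) hB1 hB2
      (hV.trans (second_moment_numerics (by linarith) ht ht0 hl hl1 hH hAB hB1)) rfl hM
  have herr := sum_sqrt_mul_le hK0.le hA3000 (by linarith) hAB
  have hfin : (A * B : ℝ) * ‖intervalCharSum χ N H‖ ≤ (A * B : ℝ) * (3.57 * √H * K) := by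
    calc _ ≤ _ := hS
      _ ≤ A * B * (2.369 * √H * K) + A * B * (1.201 * √H * K) := add_le_add hMle herr
      _ = _ := by ring
  exact le_of_mul_le_mul_left hfin (by positivity)

theorem norm_intervalCharSum_le {χ : MulChar (ZMod p) ℂ} (hχ : χ ≠ 1) (hp : 10 ^ 20 ≤ p)
    (H : ℕ) (hH : (H : ℝ) ≤ 2 * (p : ℝ) ^ ((5 : ℝ) / 8)) (N : ℤ) :
    ‖intervalCharSum χ N H‖ ≤
      3.57 * √H * ((p : ℝ) ^ ((3 : ℝ) / 16) * Real.log p ^ ((1 : ℝ) / 4)) := by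
  have hpR : (10 : ℝ) ^ 20 ≤ p := by exact_mod_cast hp
  have hp0 : (0 : ℝ) < p := by linarith [pow_pos (show (0 : ℝ) < 10 by norm_num) 20]
  have hlog : 45.7 ≤ Real.log p := by
    have h1 := Real.log_le_log (by positivity) ((by norm_num : (2 : ℝ) ^ 66 ≤ 10 ^ 20).trans hpR)
    rw [Real.log_pow] at h1
    have := Real.log_two_gt_d9
    push_cast at h1
    linarith
  have hpow (n : ℕ) : ((p : ℝ) ^ ((1 : ℝ) / 16)) ^ n = (p : ℝ) ^ ((n : ℝ) / 16) := by
    rw [← Real.rpow_mul_natCast hp0.le]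
    congr 1
    ring
  have h16 : ((p : ℝ) ^ ((1 : ℝ) / 16)) ^ 16 = p := by
    rw [hpow, Nat.cast_ofNat, div_self (by norm_num), Real.rpow_one]
  have hl : (Real.log p ^ ((1 : ℝ) / 4)) ^ 4 = Real.log p := by
    rw [← Real.rpow_mul_natCast (by linarith)]
    norm_num
  have := norm_intervalCharSum_le_aux hχ (t := (p : ℝ) ^ ((1 : ℝ) / 16))
    (l := Real.log p ^ ((1 : ℝ) / 4)) (by positivity) (Real.rpow_pos_of_pos (by linarith) _) h16
    (le_of_pow_le_pow_left₀ (n := 4) (by norm_num) (by positivity) (by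
      rw [← pow_mul, ← pow_mul, h16]
      exact hpR))
    (by rw [hl, Real.log_rpow hp0]; ring) (by rwa [hl]) H
    (by rw [hpow]; convert hH using 3; norm_num) N
  rw [hpow] at this
  exact_mod_cast this
end

theorem eq_zero_of_prod_pow_eq_one {G ι : Type*} [CommGroup G] [Fintype ι] {ψ : ι → G} {q : ι → ℕ}
    (hq : ∀ i, (q i).Prime) (hinj : Function.Injective q) (hord : ∀ i, orderOf (ψ i) = q i)
    {f : ι → ℕ} (hf : ∀ i, f i < q i) (h : ∏ i, ψ i ^ f i = 1) (i : ι) : f i = 0 := by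
  classical
  set M := ∏ j ∈ univ.erase i, q j
  have h1 : ψ i ^ (f i * M) = 1 := by
    have h2 : ∏ j ∈ univ.erase i, (ψ j ^ f j) ^ M = 1 := by
      refine prod_eq_one fun j hj => ?_
      obtain ⟨k, hk⟩ : q j ∣ M := dvd_prod_of_mem q hj
      rw [hk, ← pow_mul, mul_left_comm, pow_mul, ← hord j, pow_orderOf_eq_one, one_pow]
    have h3 : ∏ j, (ψ j ^ f j) ^ M = 1 := by rw [prod_pow, h, one_pow]
    rwa [← mul_prod_erase univ _ (mem_univ i), h2, mul_one, ← pow_mul] at h3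
  have h4 : q i ∣ f i * M := hord i ▸ orderOf_dvd_of_pow_eq_one h1
  have h5 : (q i).Coprime M := Nat.Coprime.prod_right fun j hj =>
    (Nat.coprime_primes (hq i) (hq j)).2 fun e => (mem_erase.1 hj).1 (hinj e).symm
  exact Nat.eq_zero_of_dvd_of_lt (h5.dvd_of_dvd_mul_right h4) (hf i)

/-- The coefficients of the expansion of the indicator function of `z ≠ 1` in powers of a `q`-th
root of unity `z`. -/
noncomputable def sieveCoeff (q j : ℕ) : ℝ := (if j = 0 then 1 else 0) - 1 / q

theorem sum_sieveCoeff_mul_pow {q : ℕ} (hq : q ≠ 0) {z : ℂ} (hz : z ^ q = 1) :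
    ∑ j ∈ range q, (sieveCoeff q j : ℂ) * z ^ j = if z = 1 then 0 else 1 := by
  have hq' : (q : ℂ) ≠ 0 := Nat.cast_ne_zero.2 hq
  have e : ∑ j ∈ range q, (sieveCoeff q j : ℂ) * z ^ j =
      1 - 1 / q * ∑ j ∈ range q, z ^ j := by
    rw [mul_sum, sum_congr rfl fun j _ => show (sieveCoeff q j : ℂ) * z ^ j =
      (if j = 0 then 1 else 0) - 1 / q * z ^ j by
        rw [sieveCoeff]; split_ifs with h <;> simp [h], sum_sub_distrib]
    simp [Nat.pos_of_ne_zero hq]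
  rw [e]
  split_ifs with h
  · simp [h, hq']
  · rw [geom_sum_eq h, hz]
    simp

theorem sum_abs_sieveCoeff {q : ℕ} (hq : q ≠ 0) :
    ∑ j ∈ range q, |sieveCoeff q j| = 2 * (1 - (q : ℝ)⁻¹) := by
  obtain ⟨n, rfl⟩ := Nat.exists_eq_succ_of_ne_zero hq
  rw [sum_range_succ']
  have h1 : (0 : ℝ) ≤ 1 - 1 / (n + 1 : ℕ) := by
    rw [sub_nonneg, div_le_one (by positivity)]
    exact_mod_cast Nat.le_add_left 1 n
  simp only [sieveCoeff, Nat.add_eq_zero_iff, one_ne_zero, and_false, if_false, zero_sub, abs_neg,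
    if_true, sum_const, card_range, nsmul_eq_mul, Nat.succ_eq_add_one]
  rw [abs_of_nonneg h1, abs_of_nonneg (by positivity)]
  push_cast
  field_simp
  ring

section
variable {p : ℕ} [Fact p.Prime]

theorem MulChar.prod_pow_apply {ι : Type*} (ψ : ι → MulChar (ZMod p) ℂ) (f : ι → ℕ)
    (s : Finset ι) {x : ZMod p} (hx : x ≠ 0) :
    (∏ i ∈ s, ψ i ^ f i) x = ∏ i ∈ s, ψ i x ^ f i := by
  classical
  induction s using Finset.induction_on with
  | empty => simpa using MulChar.one_apply (isUnit_iff_ne_zero.2 hx)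
  | insert i s hi ih =>
    rw [prod_insert hi, prod_insert hi, MulChar.mul_apply, ih]
    congr 1
    exact MulChar.pow_apply_coe (ψ i) (f i) (Units.mk0 x hx)

open Classical in
/-- The sieve: a family of characters of distinct prime orders takes simultaneously only values
different from `1` about as often as expected on a set over which all nontrivial characters have
small sums. -/
theorem sieve_card_lower_bound {ι : Type*} [Fintype ι] {ψ : ι → MulChar (ZMod p) ℂ} {q : ι → ℕ}
    (hq : ∀ i, (q i).Prime) (hinj : Function.Injective q) (hord : ∀ i, orderOf (ψ i) = q i)
    (s : Finset ℤ) {E : ℝ} (hE : ∀ χ : MulChar (ZMod p) ℂ, χ ≠ 1 → ‖∑ x ∈ s, χ (x : ZMod p)‖ ≤ E) :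
    (∏ i, (1 - (q i : ℝ)⁻¹)) * (#{x ∈ s | ((x : ℤ) : ZMod p) ≠ 0} -
        (2 ^ Fintype.card ι - 1) * E) ≤
      #{x ∈ s | ((x : ℤ) : ZMod p) ≠ 0 ∧ ∀ i, ψ i x ≠ 1} := by
  set P := Fintype.piFinset fun i => range (q i) with hP
  set C : (ι → ℕ) → ℝ := fun f => ∏ i, sieveCoeff (q i) (f i) with hC
  set S : (ι → ℕ) → ℂ := fun f => ∑ x ∈ s, (∏ i, ψ i ^ f i) (x : ZMod p) with hS
  have hmain : (#{x ∈ s | ((x : ℤ) : ZMod p) ≠ 0 ∧ ∀ i, ψ i x ≠ 1} : ℂ) =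
      ∑ f ∈ P, (C f : ℂ) * S f := by
    have hx (x : ℤ) : (if (x : ZMod p) ≠ 0 ∧ ∀ i, ψ i x ≠ 1 then (1 : ℂ) else 0) =
        ∑ f ∈ P, (C f : ℂ) * (∏ i, ψ i ^ f i) (x : ZMod p) := by
      by_cases h0 : (x : ZMod p) = 0
      · rw [if_neg fun h => h.1 h0, h0]
        simp only [MulChar.map_zero, mul_zero, sum_const_zero]
      · have h1 (i : ι) : ψ i x ^ q i = 1 := by
          have := MulChar.pow_apply_coe (ψ i) (q i) (Units.mk0 _ h0)
          rw [← hord i, pow_orderOf_eq_one, MulChar.one_apply_coe, Units.val_mk0] at this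
          rw [← hord i, ← this]
        have h2 := prod_univ_sum (fun i => range (q i))
          fun i j => (sieveCoeff (q i) j : ℂ) * ψ i x ^ j
        simp only [sum_sieveCoeff_mul_pow (hq _).ne_zero (h1 _), prod_mul_distrib] at h2
        simp only [MulChar.prod_pow_apply _ _ _ h0, hC, Complex.ofReal_prod, hP, ← h2]
        by_cases h3 : ∀ i, ψ i x ≠ 1
        · rw [if_pos ⟨h0, h3⟩, prod_eq_one fun i _ => if_neg (h3 i)]
        · rw [if_neg fun h => h3 h.2]
          push Not at h3
          obtain ⟨i, hi⟩ := h3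
          rw [prod_eq_zero (f := fun i => if ψ i x = 1 then (0 : ℂ) else 1)
            (mem_univ i) (if_pos hi)]
    rw [card_filter, Nat.cast_sum]
    simp only [Nat.cast_ite, Nat.cast_one, Nat.cast_zero, hx, hS, mul_sum]
    exact sum_comm
  have hz : (fun _ => 0) ∈ P := Fintype.mem_piFinset.2 fun i => mem_range.2 (hq i).pos
  have hC0 : C (fun _ => 0) = ∏ i, (1 - (q i : ℝ)⁻¹) := by simp [hC, sieveCoeff]
  have hC0' : 0 ≤ C fun _ => 0 := by
    rw [hC0]
    exact prod_nonneg fun i _ => sub_nonneg.2 (inv_le_one_of_one_le₀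
      (by exact_mod_cast (hq i).one_le))
  have hS0 : S (fun _ => 0) = #{x ∈ s | ((x : ℤ) : ZMod p) ≠ 0} := by
    rw [card_filter, Nat.cast_sum]
    refine sum_congr rfl fun x _ => ?_
    by_cases h0 : (x : ZMod p) = 0
    · simp [h0, MulChar.map_zero]
    · simp [h0, MulChar.one_apply (isUnit_iff_ne_zero.2 h0)]
  have hsum : ∑ f ∈ P, |C f| = 2 ^ Fintype.card ι * C fun _ => 0 := by
    simp only [hC, abs_prod, hP]
    rw [← prod_univ_sum (fun i => range (q i)) fun i j => |sieveCoeff (q i) j|]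
    simp only [sum_abs_sieveCoeff (hq _).ne_zero, prod_mul_distrib, prod_const, card_univ]
    congr 1
    exact hC0.symm
  have hrest : ‖∑ f ∈ P.erase fun _ => 0, (C f : ℂ) * S f‖ ≤
      (2 ^ Fintype.card ι - 1) * (C fun _ => 0) * E := by
    calc _ ≤ ∑ f ∈ P.erase fun _ => 0, |C f| * E := by
          refine norm_sum_le_of_le _ fun f hf => ?_
          rw [norm_mul, Complex.norm_real, Real.norm_eq_abs]
          refine mul_le_mul_of_nonneg_left (hE _ fun h => ?_) (abs_nonneg _)
          rw [mem_erase, Fintype.mem_piFinset] at hf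
          exact hf.1 (funext (eq_zero_of_prod_pow_eq_one hq hinj hord
            (fun i => mem_range.1 (hf.2 i)) h))
      _ = _ := by
          rw [← sum_mul]
          congr 1
          rw [← add_sum_erase P _ hz, abs_of_nonneg hC0'] at hsum
          linarith
  rw [← add_sum_erase P _ hz, hS0] at hmain
  have h : (C fun _ => 0) * (#{x ∈ s | ((x : ℤ) : ZMod p) ≠ 0} : ℝ) ≤
      #{x ∈ s | ((x : ℤ) : ZMod p) ≠ 0 ∧ ∀ i, ψ i x ≠ 1} +
        (2 ^ Fintype.card ι - 1) * (C fun _ => 0) * E := by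
    calc _ = ‖((C fun _ => 0 : ℝ) : ℂ) * (#{x ∈ s | ((x : ℤ) : ZMod p) ≠ 0} : ℂ)‖ := by
          rw [norm_mul, Complex.norm_real, Real.norm_of_nonneg hC0', Complex.norm_natCast]
      _ = ‖(#{x ∈ s | ((x : ℤ) : ZMod p) ≠ 0 ∧ ∀ i, ψ i x ≠ 1} : ℂ) -
            ∑ f ∈ P.erase fun _ => 0, (C f : ℂ) * S f‖ := by rw [hmain, add_sub_cancel_right]
      _ ≤ _ := (norm_sub_le _ _).trans (by
          rw [Complex.norm_natCast]
          exact add_le_add_right hrest _)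
  rw [← hC0]
  linarith

theorem sub_one_le_card_filter_ne_zero (N : ℤ) {H : ℕ} (hH : H < p) :
    (H : ℝ) - 1 ≤ #{x ∈ Ioc N (N + H) | ((x : ℤ) : ZMod p) ≠ 0} := by
  have h1 : #{x ∈ Ioc N (N + H) | ((x : ℤ) : ZMod p) = 0} ≤ 1 := by
    refine card_le_one.2 fun x hx y hy => ?_
    simp only [mem_filter, mem_Ioc, ZMod.intCast_zmod_eq_zero_iff_dvd] at hx hy
    exact sub_eq_zero.1 (Int.eq_zero_of_abs_lt_dvd (dvd_sub hx.2 hy.2)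
      (abs_lt.2 ⟨by omega, by omega⟩))
  have h2 := card_filter_add_card_filter_not (s := Ioc N (N + H)) fun x : ℤ => (x : ZMod p) = 0
  rw [Int.card_Ioc, add_sub_cancel_left, Int.toNat_natCast] at h2
  have h3 : H ≤ 1 + #{x ∈ Ioc N (N + H) | ((x : ℤ) : ZMod p) ≠ 0} := by
    change H ≤ 1 + #{x ∈ Ioc N (N + H) | ¬ ((x : ℤ) : ZMod p) = 0}
    omega
  have h4 : (H : ℝ) ≤ 1 + #{x ∈ Ioc N (N + H) | ((x : ℤ) : ZMod p) ≠ 0} := by exact_mod_cast h3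
  linarith
end

section
variable {p : ℕ}

theorem isEFree_of_mulChar_ne_one [Fact p.Prime] {e : ℕ} (he0 : e ≠ 0)
    {ψ : e.primeFactors → MulChar (ZMod p) ℂ} (hord : ∀ q, orderOf (ψ q) = (q : ℕ)) {x : ℤ}
    (hx : (x : ZMod p) ≠ 0) (h : ∀ q, ψ q x ≠ 1) : IsEFree p e x := by
  refine ⟨fun hd => hx ((ZMod.intCast_zmod_eq_zero_iff_dvd _ _).2 hd), ?_⟩
  rintro d hd h1 ⟨y, hy⟩
  obtain ⟨r, hr, k, rfl⟩ := Nat.exists_prime_and_dvd h1.ne'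
  have hxy : (x : ZMod p) = ((y : ZMod p) ^ k) ^ r := by
    rw [(ZMod.intCast_eq_intCast_iff _ _ _).2 hy]
    push_cast
    rw [mul_comm, pow_mul]
  have hy0 : (y : ZMod p) ^ k ≠ 0 := fun h0 => hx (by rw [hxy, h0, zero_pow hr.ne_zero])
  let i : e.primeFactors :=
    ⟨r, Nat.mem_primeFactors.2 ⟨hr, (Dvd.intro k rfl).trans hd, he0⟩⟩
  have h2 := MulChar.pow_apply_coe (ψ i) r (Units.mk0 _ hy0)
  rw [show r = orderOf (ψ i) from (hord i).symm, pow_orderOf_eq_one, MulChar.one_apply_coe,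
    Units.val_mk0, hord i] at h2
  exact h i (by rw [hxy, map_pow, h2])

theorem lt_of_le_two_mul_rpow (hp : 10 ^ 20 ≤ p) {H : ℕ}
    (hH : (H : ℝ) ≤ 2 * (p : ℝ) ^ ((5 : ℝ) / 8)) : H < p := by
  have hpR : (10 : ℝ) ^ 20 ≤ p := by exact_mod_cast hp
  have hp0 : (0 : ℝ) < p := lt_of_lt_of_le (by positivity) hpR
  have h1 : (2 : ℝ) < (p : ℝ) ^ ((3 : ℝ) / 8) := by
    calc (2 : ℝ) < ((2 : ℝ) ^ 8) ^ ((3 : ℝ) / 8) := by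
          rw [← Real.rpow_natCast, ← Real.rpow_mul (by norm_num)]
          norm_num
      _ ≤ _ := Real.rpow_le_rpow (by norm_num) ((by norm_num : (2 : ℝ) ^ 8 ≤ 10 ^ 20).trans hpR)
          (by norm_num)
  have h2 : (p : ℝ) ^ ((3 : ℝ) / 8) * (p : ℝ) ^ ((5 : ℝ) / 8) = p := by
    rw [← Real.rpow_add hp0]
    norm_num
  have : (H : ℝ) < p := by
    calc (H : ℝ) ≤ 2 * (p : ℝ) ^ ((5 : ℝ) / 8) := hH
      _ < (p : ℝ) ^ ((3 : ℝ) / 8) * (p : ℝ) ^ ((5 : ℝ) / 8) := by gcongr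
      _ = p := h2
  exact_mod_cast this

theorem thousand_le_rpow_mul_log_rpow (hp : 10 ^ 20 ≤ p) :
    1000 ≤ (p : ℝ) ^ ((3 : ℝ) / 16) * Real.log p ^ ((1 : ℝ) / 4) := by
  have hpR : (10 : ℝ) ^ 20 ≤ p := by exact_mod_cast hp
  have h1 : (1000 : ℝ) ≤ (p : ℝ) ^ ((3 : ℝ) / 16) := by
    calc (1000 : ℝ) = ((10 : ℝ) ^ 16) ^ ((3 : ℝ) / 16) := by
          rw [← Real.rpow_natCast, ← Real.rpow_mul (by norm_num)]
          norm_num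
      _ ≤ _ := Real.rpow_le_rpow (by norm_num)
          ((by norm_num : (10 : ℝ) ^ 16 ≤ 10 ^ 20).trans hpR) (by norm_num)
  have h2 : 1 ≤ Real.log p := by
    rw [Real.le_log_iff_exp_le (lt_of_lt_of_le (by positivity) hpR)]
    linarith [Real.exp_one_lt_d9]
  nlinarith [Real.one_le_rpow h2 (show (0 : ℝ) ≤ 1 / 4 by norm_num)]

end
end

theorem efree_count_lower_bound (p : ℕ) (hp : p.Prime) (hp20 : 10 ^ 20 ≤ p)
    (e : ℕ) (he : Even e) (hed : e ∣ p - 1)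
    (N H : ℤ) (hH1 : 1 ≤ H) (hH2 : (H : ℝ) ≤ 2 * (p : ℝ) ^ ((5 : ℝ) / 8)) :
    (NcountEFree p e N H : ℝ) ≥
      ((Nat.totient e : ℝ) / (e : ℝ)) *
        ((H : ℝ) - ((2 : ℝ) ^ e.primeFactors.card - 1) * 3.5751 * (H : ℝ) ^ ((1 : ℝ) / 2) *
          (p : ℝ) ^ ((3 : ℝ) / 16) * (Real.log p) ^ ((1 : ℝ) / 4)) := by
  classical
  have := Fact.mk hp
  lift H to ℕ using by omega
  rw [Int.cast_natCast] at hH2 ⊢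
  have he0 : e ≠ 0 := by
    rintro rfl
    have := hp.two_le
    have := Nat.eq_zero_of_zero_dvd hed
    omega
  have hψ (q : e.primeFactors) : ∃ ψ : MulChar (ZMod p) ℂ, orderOf ψ = (q : ℕ) := by
    have hq := Nat.mem_primeFactors.1 q.2
    refine MulChar.exists_mulChar_orderOf (ZMod p) ?_
      (Complex.isPrimitiveRoot_exp (q : ℕ) hq.1.ne_zero)
    rw [ZMod.card]
    exact hq.2.1.trans hed
  choose ψ hord using hψ
  set K := (p : ℝ) ^ ((3 : ℝ) / 16) * Real.log p ^ ((1 : ℝ) / 4) with hK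
  have hmain := sieve_card_lower_bound (q := fun q : e.primeFactors => (q : ℕ))
    (fun q => (Nat.mem_primeFactors.1 q.2).1) Subtype.val_injective hord (Finset.Ioc N (N + H))
    fun χ hχ => norm_intervalCharSum_le hχ hp20 H hH2 N
  have hunits := sub_one_le_card_filter_ne_zero N (lt_of_le_two_mul_rpow hp20 hH2)
  have hcount : Finset.card {x ∈ Finset.Ioc N (N + H) | ((x : ℤ) : ZMod p) ≠ 0 ∧ ∀ i, ψ i x ≠ 1} ≤
      NcountEFree p e N H := by
    rw [NcountEFree, ← Set.ncard_coe_finset]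
    refine Set.ncard_le_ncard (fun x hx => ?_)
      ((Set.finite_Icc (N + 1) (N + H)).subset fun x hx => ⟨hx.1, hx.2.1⟩)
    rw [Finset.mem_coe, Finset.mem_filter, Finset.mem_Ioc] at hx
    exact ⟨by omega, by omega, isEFree_of_mulChar_ne_one he0 hord hx.2.1 hx.2.2⟩
  have hφ : (Nat.totient e : ℝ) / e = ∏ q : e.primeFactors, (1 - ((q : ℕ) : ℝ)⁻¹) := by
    rw [Finset.prod_coe_sort e.primeFactors fun q : ℕ => (1 - (q : ℝ)⁻¹),
      div_eq_iff (Nat.cast_ne_zero.2 he0), mul_comm]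
    have := congrArg (Rat.cast : ℚ → ℝ) (Nat.totient_eq_mul_prod_factors e)
    push_cast at this
    exact this
  rw [← hφ, Fintype.card_coe] at hmain
  refine (hmain.trans (by exact_mod_cast hcount)).trans' ?_
  have hW : (2 : ℝ) ≤ 2 ^ e.primeFactors.card := by
    refine le_self_pow₀ one_le_two (Finset.card_ne_zero_of_mem (a := 2) ?_)
    exact Nat.mem_primeFactors.2 ⟨Nat.prime_two, he.two_dvd, he0⟩
  have hK1 : 1000 ≤ K := thousand_le_rpow_mul_log_rpow hp20
  have hH0 : 1 ≤ √(H : ℝ) := Real.one_le_sqrt.2 (by exact_mod_cast hH1)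
  have hslack : 1000 ≤ (2 ^ e.primeFactors.card - 1) * √(H : ℝ) * K := by
    calc (1000 : ℝ) = 1 * 1 * 1000 := by norm_num
      _ ≤ _ := mul_le_mul (mul_le_mul (by linarith) hH0 zero_le_one (by linarith)) hK1 (by norm_num)
          (mul_nonneg (by linarith) (Real.sqrt_nonneg _))
  rw [← Real.sqrt_eq_rpow]
  refine mul_le_mul_of_nonneg_left ?_ (by positivity)
  rw [mul_assoc _ ((p : ℝ) ^ ((3 : ℝ) / 16)), ← hK]
  linarith
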